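/- arXiv:1502.00338 — 2 statements merged into one kernel-verified Lean document; each statement's English description precedes it below -/
import Mathlib

section
/- Suppose the gains k1, k2 ∈ ℝ satisfy: 1 − k1·b2 ≠ 0, θ0 := a1 + k1·a2·b1/(1 − k1·b2) < 0, and |a3·b1·(k2 − fpe·ρ0·Veff·k1)/(ρ0·Veff·Ne·(1 − k1·b2))| < |θ0|, where a1, a2, a3 are the partial derivatives of F with respect to l, N, fp at (le, Ne, fpe) and b1 = Ne·q'(le), b2 = q(le). Then there exist constants ε > 0, M > 0 and ω > 0 such that every classical solution (l, f) of the normalized closed-loop extrusion model on [0,∞) with f of class C³ on [0,∞)×[0,1] whose initial energy E(0) := |l(0) − le|² + ∫₀¹ [(f(0,x) − fpe)² + (∂ₓf(0,x))² + (∂ₓ²f(0,x))²] dx satisfies E(0) ≤ ε obeys the exponential decay estimate E(t) ≤ M·e^{−ωt}·E(0) for all t ≥ 0, where E(t) := |l(t) − le|² + ∫₀¹ [(f(t,x) − fpe)² + (∂ₓf(t,x))² + (∂ₓ²f(t,x))²] dx. -/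
/-- Pressure coefficient `q(l) = η·ρ0·Veff·(L − l)/(B·ρ0 + Kd·(L − l))` of the isothermal
extrusion model. -/
noncomputable def qfun (η ρ0 Veff L B Kd : ℝ) (l : ℝ) : ℝ :=
  η * ρ0 * Veff * (L - l) / (B * ρ0 + Kd * (L - l))

/-- Interface velocity
`F(l, N, fp) = ((Kd/η)·N·q(l) − ρ0·Veff·N·fp)/(ρ0·Seff·(1 − fp))` of the isothermal
extrusion model. -/
noncomputable def Ffun (η ρ0 Veff Seff L B Kd : ℝ) (l N fp : ℝ) : ℝ :=
  ((Kd / η) * N * qfun η ρ0 Veff L B Kd l - ρ0 * Veff * N * fp) / (ρ0 * Seff * (1 - fp))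

open Set Filter Topology

/-- Partial derivative with respect to the first variable. -/
noncomputable def partialFst (f : ℝ → ℝ → ℝ) (t x : ℝ) : ℝ := deriv (fun s => f s x) t

/-- Partial derivative with respect to the second variable. -/
noncomputable def partialSnd (f : ℝ → ℝ → ℝ) (t x : ℝ) : ℝ := deriv (f t) x

lemma hasDerivAt_partialFst {f : ℝ → ℝ → ℝ} (hf : ContDiff ℝ 1 (Function.uncurry f))
    (t x : ℝ) : HasDerivAt (fun s => f s x) (partialFst f t x) t := by
  have h : DifferentiableAt ℝ (fun s => Function.uncurry f (s, x)) t :=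
    ((hf.differentiable one_ne_zero) (t, x)).comp t
      (f := fun s : ℝ => (s, x)) (by fun_prop)
  exact h.hasDerivAt

lemma hasDerivAt_partialSnd {f : ℝ → ℝ → ℝ} (hf : ContDiff ℝ 1 (Function.uncurry f))
    (t x : ℝ) : HasDerivAt (f t) (partialSnd f t x) x := by
  have h : DifferentiableAt ℝ (fun y => Function.uncurry f (t, y)) x :=
    ((hf.differentiable one_ne_zero) (t, x)).comp x
      (f := fun y : ℝ => (t, y)) (by fun_prop)
  exact h.hasDerivAt

lemma partialFst_eq_fderiv {f : ℝ → ℝ → ℝ} (hf : ContDiff ℝ 1 (Function.uncurry f))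
    (t x : ℝ) : partialFst f t x = fderiv ℝ (Function.uncurry f) (t, x) (1, 0) := by
  have h := ((hf.differentiable one_ne_zero) (t, x)).hasFDerivAt.comp_hasDerivAt t
    ((hasDerivAt_id t).prodMk (hasDerivAt_const t x))
  exact h.deriv

lemma partialSnd_eq_fderiv {f : ℝ → ℝ → ℝ} (hf : ContDiff ℝ 1 (Function.uncurry f))
    (t x : ℝ) : partialSnd f t x = fderiv ℝ (Function.uncurry f) (t, x) (0, 1) := by
  have h := ((hf.differentiable one_ne_zero) (t, x)).hasFDerivAt.comp_hasDerivAt x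
    ((hasDerivAt_const x t).prodMk (hasDerivAt_id x))
  exact h.deriv

lemma uncurry_partialFst {f : ℝ → ℝ → ℝ} (hf : ContDiff ℝ 1 (Function.uncurry f)) :
    Function.uncurry (partialFst f) = fun p => fderiv ℝ (Function.uncurry f) p (1, 0) := by
  ext ⟨t, x⟩
  exact partialFst_eq_fderiv hf t x

lemma uncurry_partialSnd {f : ℝ → ℝ → ℝ} (hf : ContDiff ℝ 1 (Function.uncurry f)) :
    Function.uncurry (partialSnd f) = fun p => fderiv ℝ (Function.uncurry f) p (0, 1) := by
  ext ⟨t, x⟩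
  exact partialSnd_eq_fderiv hf t x

lemma contDiff_partialFst {f : ℝ → ℝ → ℝ} {n : ℕ}
    (hf : ContDiff ℝ (n + 1) (Function.uncurry f)) :
    ContDiff ℝ n (Function.uncurry (partialFst f)) := by
  rw [uncurry_partialFst (hf.of_le (by simp))]
  exact (hf.fderiv_right le_rfl).clm_apply contDiff_const

lemma contDiff_partialSnd {f : ℝ → ℝ → ℝ} {n : ℕ}
    (hf : ContDiff ℝ (n + 1) (Function.uncurry f)) :
    ContDiff ℝ n (Function.uncurry (partialSnd f)) := by
  rw [uncurry_partialSnd (hf.of_le (by simp))]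
  exact (hf.fderiv_right le_rfl).clm_apply contDiff_const

lemma partialSnd_partialFst_comm {f : ℝ → ℝ → ℝ} (hf : ContDiff ℝ 2 (Function.uncurry f))
    (t x : ℝ) : partialSnd (partialFst f) t x = partialFst (partialSnd f) t x := by
  have h1 : ContDiff ℝ 1 (Function.uncurry f) := hf.of_le (by norm_num)
  have h2 : Differentiable ℝ (fderiv ℝ (Function.uncurry f)) :=
    (hf.fderiv_right (m := 1) (by norm_num)).differentiable one_ne_zero
  rw [partialSnd_eq_fderiv (contDiff_partialFst (n := 1) (by exact_mod_cast hf)),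
    partialFst_eq_fderiv (contDiff_partialSnd (n := 1) (by exact_mod_cast hf)),
    uncurry_partialFst h1, uncurry_partialSnd h1,
    fderiv_clm_apply (h2 _) (differentiableAt_const _),
    fderiv_clm_apply (h2 _) (differentiableAt_const _)]
  have hs : IsSymmSndFDerivAt ℝ (Function.uncurry f) (t, x) :=
    hf.contDiffAt.isSymmSndFDerivAt (by simp)
  simpa using hs (0, 1) (1, 0)

/-- Two functions that agree on `[a, b]` have the same derivative there. -/
lemma HasDerivAt.unique_of_eqOn_Icc {u v : ℝ → ℝ} {u' v' a b x : ℝ} (hab : a < b)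
    (hx : x ∈ Icc a b) (hu : HasDerivAt u u' x) (hv : HasDerivAt v v' x)
    (h : EqOn u v (Icc a b)) : u' = v' :=
  (uniqueDiffOn_Icc hab x hx).eq_deriv _ hu.hasDerivWithinAt
    (hv.hasDerivWithinAt.congr h (h hx))

/-- Two functions that agree on `[0, ∞)` near `t ≥ 0` have the same derivative at `t`. -/
lemma HasDerivAt.unique_of_eventually_Ici {u v : ℝ → ℝ} {u' v' t : ℝ} (ht : 0 ≤ t)
    (hu : HasDerivAt u u' t) (hv : HasDerivAt v v' t)
    (h : ∀ᶠ s in 𝓝 t, 0 ≤ s → u s = v s) : u' = v' := by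
  refine ((uniqueDiffOn_Ici (0 : ℝ)) t ht).eq_deriv _ hu.hasDerivWithinAt
    (hv.hasDerivWithinAt.congr_of_eventuallyEq ?_ (h.self_of_nhds ht))
  exact eventually_nhdsWithin_iff.2 h

/-- Differentiating a linear transport equation in space. -/
lemma transport_partialSnd {z : ℝ → ℝ → ℝ} (hz : ContDiff ℝ 2 (Function.uncurry z))
    {t A B k : ℝ}
    (h : ∀ x ∈ Icc (0 : ℝ) 1, partialFst z t x + (A - B * x) * partialSnd z t x = k * B * z t x) :
    ∀ x ∈ Icc (0 : ℝ) 1, partialFst (partialSnd z) t x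
      + (A - B * x) * partialSnd (partialSnd z) t x = (k + 1) * B * partialSnd z t x := by
  intro x hx
  have h1 := hasDerivAt_partialSnd (contDiff_partialFst (n := 1) (by exact_mod_cast hz)) t x
  have h2 := hasDerivAt_partialSnd (contDiff_partialSnd (n := 1) (by exact_mod_cast hz)) t x
  have h3 := hasDerivAt_partialSnd (hz.of_le (by norm_num)) t x
  have h4 : HasDerivAt (fun x => A - B * x) (-(B * 1)) x :=
    ((hasDerivAt_id x).const_mul B).const_sub A
  have h5 := (h1.add (h4.mul h2)).unique_of_eqOn_Icc one_pos hx (h3.const_mul (k * B)) h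
  rw [partialSnd_partialFst_comm hz] at h5
  linarith

/-- Differentiation of the integral of a `C¹` function with respect to a parameter. -/
lemma hasDerivAt_integral_of_contDiff {g : ℝ → ℝ → ℝ} (hg : ContDiff ℝ 1 (Function.uncurry g))
    (t : ℝ) : HasDerivAt (fun s => ∫ x in (0 : ℝ)..1, g s x)
      (∫ x in (0 : ℝ)..1, partialFst g t x) t := by
  have hc : Continuous (Function.uncurry g) := hg.continuous
  have hc' : Continuous (Function.uncurry (partialFst g)) :=
    (contDiff_partialFst (n := 0) (by simpa using hg)).continuous
  obtain ⟨C, hC⟩ := (isCompact_Icc (a := t - 1) (b := t + 1)).prod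
    (isCompact_Icc (a := (0 : ℝ)) (b := 1)) |>.exists_bound_of_continuousOn hc'.continuousOn
  have hslice : ∀ (w : ℝ → ℝ → ℝ), Continuous (Function.uncurry w) → ∀ s, Continuous (w s) :=
    fun w hw s => hw.comp (by fun_prop : Continuous fun x : ℝ => (s, x))
  refine (intervalIntegral.hasDerivAt_integral_of_dominated_loc_of_deriv_le
    (F' := partialFst g) (bound := fun _ => C)
    (Icc_mem_nhds (by linarith : t - 1 < t) (by linarith : t < t + 1))
    (Eventually.of_forall fun s => (hslice g hc s).aestronglyMeasurable)
    ((hslice g hc t).intervalIntegrable _ _) (hslice _ hc' t).aestronglyMeasurable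
    (Eventually.of_forall fun x hx s hs => hC (s, x) ⟨hs, ?_⟩)
    (by simp) (Eventually.of_forall fun x _ s _ => hasDerivAt_partialFst hg s x)).2
  rw [uIoc_of_le zero_le_one] at hx
  exact ⟨hx.1.le, hx.2⟩

/-- Weighted `L²` energy on the unit interval. -/
noncomputable def weightedEnergy (μ : ℝ) (z : ℝ → ℝ → ℝ) (t : ℝ) : ℝ :=
  ∫ x in (0 : ℝ)..1, Real.exp (-μ * x) * z t x ^ 2

/-- Dissipation of the weighted energy along a linear transport equation. -/
lemma exists_hasDerivAt_weightedEnergy {z : ℝ → ℝ → ℝ}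
    (hz : ContDiff ℝ 1 (Function.uncurry z)) {t A B k μ κ : ℝ}
    (h : ∀ x ∈ Icc (0 : ℝ) 1, partialFst z t x + (A - B * x) * partialSnd z t x = k * B * z t x)
    (hκ : ∀ x ∈ Icc (0 : ℝ) 1, κ ≤ μ * (A - B * x) - (2 * k - 1) * B) :
    ∃ D, HasDerivAt (weightedEnergy μ z) D t ∧
      D ≤ A * z t 0 ^ 2 - Real.exp (-μ) * (A - B) * z t 1 ^ 2 - κ * weightedEnergy μ z t := by
  set g : ℝ → ℝ → ℝ := fun s x => Real.exp (-μ * x) * z s x ^ 2 with hg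
  have hgc : ContDiff ℝ 1 (Function.uncurry g) := by
    have : ContDiff ℝ 1 fun p : ℝ × ℝ => Real.exp (-μ * p.2) := by fun_prop
    exact this.mul (hz.pow 2)
  refine ⟨_, hasDerivAt_integral_of_contDiff hgc t, ?_⟩
  have hgt : ∀ x, partialFst g t x = Real.exp (-μ * x) * (2 * z t x * partialFst z t x) := by
    intro x
    refine HasDerivAt.deriv ?_
    have := ((hasDerivAt_partialFst hz t x).pow 2).const_mul (Real.exp (-μ * x))
    exact this.congr_deriv (by simp)
  have hexp : ∀ x : ℝ, HasDerivAt (fun x => Real.exp (-μ * x)) (Real.exp (-μ * x) * (-μ * 1)) x :=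
    fun x => ((hasDerivAt_id x).const_mul (-μ)).exp
  have hα : ∀ x : ℝ, HasDerivAt (fun x => A - B * x) (-(B * 1)) x :=
    fun x => ((hasDerivAt_id x).const_mul B).const_sub A
  have hflux : ∀ x : ℝ, HasDerivAt (fun x => (A - B * x) * g t x)
      (-(B * 1) * g t x + (A - B * x) * (Real.exp (-μ * x) * (-μ * 1) * z t x ^ 2 +
        Real.exp (-μ * x) * (2 * z t x * partialSnd z t x))) x := by
    intro x
    have := (hα x).mul ((hexp x).mul ((hasDerivAt_partialSnd hz t x).pow 2))
    exact this.congr_deriv (by simp [hg])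
  have hzc : Continuous (z t) :=
    hz.continuous.comp (by fun_prop : Continuous fun x : ℝ => (t, x))
  have hzx : Continuous (partialSnd z t) :=
    (contDiff_partialSnd (n := 0) (f := z) (by simpa using hz)).continuous.comp
      (by fun_prop : Continuous fun x : ℝ => (t, x))
  have hgt_c : Continuous (partialFst g t) :=
    (contDiff_partialFst (n := 0) (f := g) (by simpa using hgc)).continuous.comp
      (by fun_prop : Continuous fun x : ℝ => (t, x))
  have hgc' : Continuous (g t) := by simp only [hg]; fun_prop
  have hftc := intervalIntegral.integral_eq_sub_of_hasDerivAt (a := 0) (b := 1)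
    (fun x _ => hflux x) (Continuous.intervalIntegrable (by fun_prop) _ _)
  have hmono : ∫ x in (0 : ℝ)..1, partialFst g t x ≤
      ∫ x in (0 : ℝ)..1, (-(-(B * 1) * g t x + (A - B * x) *
        (Real.exp (-μ * x) * (-μ * 1) * z t x ^ 2 +
          Real.exp (-μ * x) * (2 * z t x * partialSnd z t x))) - κ * g t x) := by
    refine intervalIntegral.integral_mono_on zero_le_one (hgt_c.intervalIntegrable _ _)
      (Continuous.intervalIntegrable (by fun_prop) _ _) fun x hx => ?_
    rw [hgt]
    have e1 : partialFst z t x = k * B * z t x - (A - B * x) * partialSnd z t x := by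
      linarith [h x hx]
    have e2 : 0 ≤ (μ * (A - B * x) - (2 * k - 1) * B - κ) * (Real.exp (-μ * x) * z t x ^ 2) :=
      mul_nonneg (by linarith [hκ x hx]) (by positivity)
    rw [e1]
    simp only [hg]
    nlinarith [e2]
  refine hmono.trans (le_of_eq ?_)
  rw [intervalIntegral.integral_sub (Continuous.intervalIntegrable (by fun_prop) _ _)
    (Continuous.intervalIntegrable (by fun_prop) _ _), intervalIntegral.integral_neg, hftc,
    intervalIntegral.integral_const_mul]
  simp only [hg, weightedEnergy]
  simp
  ring

/-- One-dimensional Sobolev estimate of a boundary value. -/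
lemma sq_le_integral_sq_add_integral_deriv_sq {u u' : ℝ → ℝ} (hu : ∀ x, HasDerivAt u (u' x) x)
    (hc : Continuous u') :
    u 1 ^ 2 ≤ ∫ x in (0 : ℝ)..1, (2 * u x ^ 2 + u' x ^ 2) := by
  have huc : Continuous u := continuous_iff_continuousAt.2 fun x => (hu x).continuousAt
  have hd : ∀ x, HasDerivAt (fun x => x * u x ^ 2) (1 * u x ^ 2 + x * (2 * u x * u' x)) x := by
    intro x
    exact ((hasDerivAt_id x).mul ((hu x).pow 2)).congr_deriv (by simp)
  have hftc := intervalIntegral.integral_eq_sub_of_hasDerivAt (a := 0) (b := 1)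
    (fun x _ => hd x) (Continuous.intervalIntegrable (by fun_prop) _ _)
  have hmono : ∫ x in (0 : ℝ)..1, (1 * u x ^ 2 + x * (2 * u x * u' x)) ≤
      ∫ x in (0 : ℝ)..1, (2 * u x ^ 2 + u' x ^ 2) := by
    refine intervalIntegral.integral_mono_on zero_le_one
      (Continuous.intervalIntegrable (by fun_prop) _ _)
      (Continuous.intervalIntegrable (by fun_prop) _ _) fun x hx => ?_
    nlinarith [mul_nonneg hx.1 (sq_nonneg (u x - u' x)),
      mul_nonneg (sub_nonneg.2 hx.2) (add_nonneg (sq_nonneg (u x)) (sq_nonneg (u' x)))]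
  simp only [one_mul, zero_mul, sub_zero] at hftc hmono
  linarith

/-- Local exponential decay from a differential inequality that holds below a threshold. -/
lemma exp_decay_of_deriv_le_of_le {V V' : ℝ → ℝ} {δ ω : ℝ} (hω : 0 < ω)
    (hV : ∀ t, 0 ≤ t → HasDerivAt V (V' t) t) (hV0 : 0 ≤ V 0) (hδ : V 0 < δ)
    (h : ∀ t, 0 ≤ t → V t ≤ δ → V' t ≤ -ω * V t) :
    ∀ t, 0 ≤ t → V t ≤ V 0 * Real.exp (-(ω / 2) * t) := by
  intro t ht
  have key : ∀ K, V 0 < K → K < δ → V t ≤ K * Real.exp (-(ω / 2) * t) := by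
    intro K hK hKδ
    have hK0 : 0 < K := hV0.trans_lt hK
    have hB : ∀ x : ℝ, HasDerivAt (fun s => K * Real.exp (-(ω / 2) * s))
        (K * (Real.exp (-(ω / 2) * x) * (-(ω / 2) * 1))) x :=
      fun x => ((hasDerivAt_id x).const_mul (-(ω / 2))).exp.const_mul K
    refine image_le_of_deriv_right_lt_deriv_boundary' (f := V) (f' := V') (a := 0) (b := t)
      (B := fun s => K * Real.exp (-(ω / 2) * s))
      (fun x hx => (hV x hx.1).continuousAt.continuousWithinAt)
      (fun x hx => (hV x hx.1).hasDerivWithinAt) (by simpa using hK.le)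
      (fun x _ => (hB x).continuousAt.continuousWithinAt)
      (fun x _ => (hB x).hasDerivWithinAt) ?_ ⟨ht, le_rfl⟩
    intro x hx hVB
    have hpos : 0 < K * Real.exp (-(ω / 2) * x) := by positivity
    have hle : Real.exp (-(ω / 2) * x) ≤ 1 := by
      rw [Real.exp_le_one_iff]; nlinarith [hx.1]
    have h1 := h x hx.1 (by rw [hVB]; nlinarith)
    rw [hVB] at h1
    nlinarith
  have hlim : Tendsto (fun K => K * Real.exp (-(ω / 2) * t)) (𝓝[>] (V 0))
      (𝓝 (V 0 * Real.exp (-(ω / 2) * t))) :=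
    ((continuous_id.mul continuous_const).tendsto _).mono_left nhdsWithin_le_nhds
  refine ge_of_tendsto hlim ?_
  filter_upwards [Ioo_mem_nhdsGT hδ] with K hK using key K hK.1 hK.2

/-- Weights for a quadratic Lyapunov function of the linearised delay system. -/
lemma exists_lyapunov_weights {θ a γ A : ℝ} (hθ : θ < 0) (hA : 0 < A) (h : |a * γ| < |θ|) :
    ∃ s c ρ ν : ℝ, |γ| < s ∧ 0 < c ∧ 0 < ρ ∧ ρ < 1 ∧ 0 < ν ∧ ∀ y u : ℝ,
      2 * θ * y ^ 2 + 2 * a * y * u + c * (A * s ^ 2 * y ^ 2) - c * (ρ * A * u ^ 2) ≤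
        -ν * (y ^ 2 + u ^ 2) := by
  obtain ⟨s, hs, has⟩ : ∃ s, |γ| < s ∧ |a| * s < |θ| := by
    have h1 : 0 < |a| + 1 := by positivity
    have h2 : 0 < |θ| - |a * γ| := by linarith
    refine ⟨|γ| + (|θ| - |a * γ|) / (2 * (|a| + 1)), lt_add_of_pos_right _ (div_pos h2 (by positivity)), ?_⟩
    have h3 : |a| * ((|θ| - |a * γ|) / (2 * (|a| + 1))) < |θ| - |a * γ| := by
      rw [mul_div_assoc', div_lt_iff₀ (by positivity)]
      nlinarith [abs_nonneg a]
    rw [mul_add, ← abs_mul]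
    linarith
  have hs0 : 0 < s := (abs_nonneg γ).trans_lt hs
  rw [abs_of_neg hθ] at has
  have hsq : a ^ 2 * s ^ 2 < θ ^ 2 := by
    have h0 : 0 ≤ |a| * s := by positivity
    have := pow_lt_pow_left₀ has h0 two_ne_zero
    rwa [mul_pow, sq_abs, neg_sq] at this
  have hθ2 : 0 < θ ^ 2 := by nlinarith
  set ρ : ℝ := (1 + a ^ 2 * s ^ 2 / θ ^ 2) / 2 with hρ
  have hq : a ^ 2 * s ^ 2 / θ ^ 2 < 1 := by rwa [div_lt_one hθ2]
  have hq0 : 0 ≤ a ^ 2 * s ^ 2 / θ ^ 2 := by positivity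
  have hρa : a ^ 2 * s ^ 2 < θ ^ 2 * ρ := by
    have : a ^ 2 * s ^ 2 / θ ^ 2 < ρ := by rw [hρ]; linarith
    rwa [div_lt_iff₀' hθ2] at this
  have hp : 0 < -θ := by linarith
  have hρ0 : 0 < ρ := by rw [hρ]; linarith
  set r : ℝ := -θ * ρ / s ^ 2 with hr
  have hr0 : 0 < r := by positivity
  have hpr : a ^ 2 < -θ * r := by
    rw [hr, mul_div_assoc', lt_div_iff₀ (by positivity)]
    nlinarith
  set ν : ℝ := (-θ * r - a ^ 2) / (-θ + r) with hν
  have hpr0 : 0 < -θ + r := by linarith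
  have hν0 : 0 < ν := div_pos (by linarith) hpr0
  have hνe : ν * (-θ + r) = -θ * r - a ^ 2 := by rw [hν]; field_simp
  have hνp : ν < -θ := by
    rw [hν, div_lt_iff₀ hpr0]; nlinarith [sq_nonneg a]
  refine ⟨s, -θ / (A * s ^ 2), ρ, ν, hs, by positivity, hρ0, by rw [hρ]; linarith, hν0,
    fun y u => ?_⟩
  have e1 : -θ / (A * s ^ 2) * (A * s ^ 2 * y ^ 2) = -θ * y ^ 2 := by field_simp
  have e2 : -θ / (A * s ^ 2) * (ρ * A * u ^ 2) = r * u ^ 2 := by rw [hr]; field_simp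
  rw [e1, e2]
  have e3 : 0 ≤ (-θ - ν) * ((-θ - ν) * y ^ 2 - 2 * a * y * u + (r - ν) * u ^ 2) := by
    have : (-θ - ν) * (r - ν) = a ^ 2 + ν ^ 2 := by linarith
    nlinarith [sq_nonneg ((-θ - ν) * y - a * u), sq_nonneg (ν * u)]
  have e4 := nonneg_of_mul_nonneg_right e3 (by linarith)
  linarith

lemma sq_norm_le_add_sq (p : ℝ × ℝ) : ‖p‖ ^ 2 ≤ p.1 ^ 2 + p.2 ^ 2 := by
  rw [Prod.norm_def]
  rcases max_choice ‖p.1‖ ‖p.2‖ with h | h <;> rw [h, Real.norm_eq_abs, sq_abs]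
  · nlinarith [sq_nonneg p.2]
  · nlinarith [sq_nonneg p.1]

lemma eventually_sq_le_of_differentiableAt {Φ : ℝ × ℝ → ℝ} {q : ℝ × ℝ}
    (hΦ : DifferentiableAt ℝ Φ q) (h0 : Φ q = 0) :
    ∃ K > 0, ∀ᶠ p in 𝓝 q, Φ p ^ 2 ≤ K * ((p.1 - q.1) ^ 2 + (p.2 - q.2) ^ 2) := by
  obtain ⟨c, hc, h⟩ := hΦ.hasFDerivAt.isBigO_sub.exists_pos
  refine ⟨c ^ 2, by positivity, ?_⟩
  filter_upwards [h.bound] with p hp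
  rw [h0, sub_zero, Real.norm_eq_abs] at hp
  calc Φ p ^ 2 = |Φ p| ^ 2 := (sq_abs _).symm
    _ ≤ (c * ‖p - q‖) ^ 2 := pow_le_pow_left₀ (abs_nonneg _) hp 2
    _ = c ^ 2 * ‖p - q‖ ^ 2 := mul_pow _ _ _
    _ ≤ _ := by gcongr; exact sq_norm_le_add_sq (p - q)

lemma eventually_mul_le_of_hasFDerivAt {G : ℝ × ℝ → ℝ} {G' : ℝ × ℝ →L[ℝ] ℝ} {q : ℝ × ℝ}
    (hG : HasFDerivAt G G' q) (h0 : G q = 0) {σ : ℝ} (hσ : 0 < σ) :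
    ∀ᶠ p in 𝓝 q, 2 * (p.1 - q.1) * G p ≤ 2 * G' (1, 0) * (p.1 - q.1) ^ 2
      + 2 * G' (0, 1) * (p.1 - q.1) * (p.2 - q.2)
      + σ * ((p.1 - q.1) ^ 2 + (p.2 - q.2) ^ 2) := by
  filter_upwards [hG.isLittleO.def (half_pos hσ)] with p hp
  have hlin : G' (p - q) = G' (1, 0) * (p.1 - q.1) + G' (0, 1) * (p.2 - q.2) := by
    have : p - q = (p.1 - q.1) • ((1 : ℝ), (0 : ℝ)) + (p.2 - q.2) • ((0 : ℝ), (1 : ℝ)) := by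
      ext <;> simp
    rw [this, map_add, map_smul, map_smul, smul_eq_mul, smul_eq_mul]
    ring
  rw [h0, sub_zero, hlin] at hp
  set R := G p - (G' (1, 0) * (p.1 - q.1) + G' (0, 1) * (p.2 - q.2)) with hR
  have h1 : |p.1 - q.1| ≤ ‖p - q‖ := norm_fst_le (p - q)
  have h2 := sq_norm_le_add_sq (p - q)
  have h3 : (p.1 - q.1) * R ≤ σ / 2 * ‖p - q‖ ^ 2 := by
    calc (p.1 - q.1) * R ≤ |p.1 - q.1| * ‖R‖ := by
          rw [Real.norm_eq_abs, ← abs_mul]; exact le_abs_self _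
      _ ≤ ‖p - q‖ * (σ / 2 * ‖p - q‖) := by gcongr
      _ = _ := by ring
  have h4 : G p = R + (G' (1, 0) * (p.1 - q.1) + G' (0, 1) * (p.2 - q.2)) := by rw [hR]; ring
  rw [h4]
  simp only [Prod.fst_sub, Prod.snd_sub] at h2
  nlinarith

lemma eventually_mul_sq_sub_le {g A : ℝ → ℝ} {γ s q : ℝ} (hg : HasDerivAt g γ q)
    (hA : ContinuousAt A q) (hA0 : 0 < A q) (hs : |γ| < s) :
    ∀ᶠ l in 𝓝 q, A l * (g l - g q) ^ 2 ≤ A q * s ^ 2 * (l - q) ^ 2 := by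
  obtain ⟨s', hs', hs's⟩ := exists_between hs
  have hs'0 : 0 < s' := (abs_nonneg γ).trans_lt hs'
  have hlt : A q * s' ^ 2 < A q * s ^ 2 := by
    have := pow_lt_pow_left₀ hs's hs'0.le two_ne_zero
    gcongr
  filter_upwards [hg.isLittleO.def (sub_pos.2 hs'),
    (hA.mul_const (s' ^ 2)).eventually (gt_mem_nhds hlt),
    hA.eventually (lt_mem_nhds hA0)] with l h1 h2 h3
  have h4 : |g l - g q| ≤ s' * |l - q| := by
    have : |g l - g q| ≤ |g l - g q - (l - q) * γ| + |(l - q) * γ| := by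
      simpa using abs_add_le (g l - g q - (l - q) * γ) ((l - q) * γ)
    simp only [Real.norm_eq_abs, smul_eq_mul] at h1
    rw [abs_mul (l - q)] at this
    nlinarith
  have h5 : (g l - g q) ^ 2 ≤ s' ^ 2 * (l - q) ^ 2 := by
    rw [← sq_abs (g l - g q), ← sq_abs (l - q), ← mul_pow]
    exact pow_le_pow_left₀ (abs_nonneg _) h4 2
  calc A l * (g l - g q) ^ 2 ≤ A l * (s' ^ 2 * (l - q) ^ 2) := by gcongr
    _ = A l * s' ^ 2 * (l - q) ^ 2 := by ring
    _ ≤ _ := by gcongr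

/-- The trace at `x = 0` of the space derivative, as a function of the interface position and of
the outlet value. -/
noncomputable def slopeTrace (g A : ℝ → ℝ) (G : ℝ × ℝ → ℝ) (p : ℝ × ℝ) : ℝ :=
  -(deriv g p.1 * G p) / A p.1

lemma analyticAt_slopeTrace {g A : ℝ → ℝ} {G : ℝ × ℝ → ℝ} {q : ℝ × ℝ}
    (hg : AnalyticAt ℝ g q.1) (hA : AnalyticAt ℝ A q.1) (hG : AnalyticAt ℝ G q)
    (hA0 : A q.1 ≠ 0) : AnalyticAt ℝ (slopeTrace g A G) q := by
  have h1 : AnalyticAt ℝ (fun p : ℝ × ℝ => deriv g p.1) q :=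
    AnalyticAt.fun_comp (g := deriv g) hg.deriv analyticAt_fst
  have h2 : AnalyticAt ℝ (fun p : ℝ × ℝ => A p.1) q :=
    AnalyticAt.fun_comp (g := A) hA analyticAt_fst
  exact ((h1.mul hG).neg).div h2 hA0

/-- Bound on the trace at `x = 0` of the second space derivative. -/
lemma mul_sq_curvatureTrace_le {Ae A B C G KG KΦ X v0 v1 w0 n : ℝ} (hAe : 0 < Ae)
    (hA : Ae / 2 ≤ A) (hAB : |A - B| ≤ 2 * Ae) (hB : |B| ≤ 1) (hG : G ^ 2 ≤ KG * n)
    (hv : v0 ^ 2 ≤ KΦ * n) (hKG : 0 ≤ KG) (hKΦ : 0 ≤ KΦ) (hn : 0 ≤ n)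
    (hX : X ^ 2 ≤ C ^ 2 * (G ^ 2 + ((A - B) * v1) ^ 2)) (hw : A * w0 = -(X - B * v0)) :
    A * w0 ^ 2 ≤ 2 / Ae * (2 * C ^ 2 * KG + 2 * KΦ + 8 * C ^ 2 * Ae ^ 2) * (n + v1 ^ 2) := by
  have hA0 : 0 < A := by linarith
  have hAB2 : (A - B) ^ 2 ≤ 4 * Ae ^ 2 := by
    rw [← sq_abs]; nlinarith [abs_nonneg (A - B)]
  have hB2 : B ^ 2 ≤ 1 := by rw [← sq_abs]; nlinarith [abs_nonneg B]
  have h1 : ((A - B) * v1) ^ 2 ≤ 4 * Ae ^ 2 * v1 ^ 2 := by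
    rw [mul_pow]; gcongr
  have h2 : X ^ 2 ≤ C ^ 2 * (KG * n + 4 * Ae ^ 2 * v1 ^ 2) := by
    refine hX.trans ?_; gcongr
  have h3 : (B * v0) ^ 2 ≤ KΦ * n := by
    rw [mul_pow]; nlinarith [sq_nonneg v0]
  have h4 : (A * w0) ^ 2 ≤ 2 * X ^ 2 + 2 * (B * v0) ^ 2 := by
    rw [hw]; nlinarith [sq_nonneg (X + B * v0)]
  set S := 2 * C ^ 2 * KG + 2 * KΦ + 8 * C ^ 2 * Ae ^ 2 with hS
  have h5 : (A * w0) ^ 2 ≤ S * (n + v1 ^ 2) := by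
    have e1 : 0 ≤ C ^ 2 * KG * v1 ^ 2 := by positivity
    have e2 : 0 ≤ KΦ * v1 ^ 2 := by positivity
    have e3 : 0 ≤ C ^ 2 * Ae ^ 2 * n := by positivity
    rw [hS]; nlinarith
  have h6 : A * w0 ^ 2 = (A * w0) ^ 2 / A := by field_simp
  rw [h6, div_le_iff₀ hA0]
  have h7 : 1 ≤ 2 / Ae * A := by
    rw [div_mul_eq_mul_div, le_div_iff₀ hAe]; linarith
  have h8 : 0 ≤ S * (n + v1 ^ 2) := (sq_nonneg _).trans h5
  nlinarith

lemma rate_le {Ae a B μ k x : ℝ} (hμ : 0 < μ) (ha : 3 / 4 * Ae ≤ a)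
    (hB : |B| ≤ μ * Ae / (4 * (μ + 3))) (hk : k ∈ Icc (0 : ℝ) 2) (hx : x ∈ Icc (0 : ℝ) 1) :
    μ * Ae / 2 ≤ μ * (a - B * x) - (2 * k - 1) * B := by
  rw [le_div_iff₀ (by positivity)] at hB
  have hk1 : (2 * k - 1) * B ≤ 3 * |B| := by
    calc (2 * k - 1) * B ≤ |2 * k - 1| * |B| := by rw [← abs_mul]; exact le_abs_self _
      _ ≤ 3 * |B| := by
        gcongr
        rw [abs_le]; constructor <;> linarith [hk.1, hk.2]
  have hx1 : B * x ≤ |B| := by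
    calc B * x ≤ |B| * x := mul_le_mul_of_nonneg_right (le_abs_self B) hx.1
      _ ≤ |B| * 1 := mul_le_mul_of_nonneg_left hx.2 (abs_nonneg B)
      _ = |B| := mul_one _
  have h1 := mul_le_mul_of_nonneg_left ha hμ.le
  have h2 := mul_le_mul_of_nonneg_left hx1 hμ.le
  linarith

set_option maxHeartbeats 1000000 in
/-- Pointwise dissipation inequality near the equilibrium. -/
lemma exists_local_dissipation {g A : ℝ → ℝ} {G : ℝ × ℝ → ℝ} {q : ℝ × ℝ}
    (hg : AnalyticAt ℝ g q.1) (hA : AnalyticAt ℝ A q.1) (hG : AnalyticAt ℝ G q)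
    (hq : 0 < q.1) (hA0 : 0 < A q.1) (hg0 : g q.1 = q.2) (hG0 : G q = 0)
    (hθ : fderiv ℝ G q (1, 0) < 0)
    (hgain : |fderiv ℝ G q (0, 1) * deriv g q.1| < |fderiv ℝ G q (1, 0)|) :
    ∃ μ > 0, ∃ κ > 0, ∃ ν > 0, ∃ c₀ > 0, ∃ c₁ > 0, ∃ c₂ > 0, ∀ᶠ p in 𝓝 q,
      0 < A p.1 ∧ DifferentiableAt ℝ g p.1 ∧ DifferentiableAt ℝ (slopeTrace g A G) p ∧
      G p / p.1 ≤ A p.1 ∧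
      (∀ k ∈ Icc (0 : ℝ) 2, ∀ x ∈ Icc (0 : ℝ) 1,
        κ ≤ μ * (A p.1 - G p / p.1 * x) - (2 * k - 1) * (G p / p.1)) ∧
      ∀ v1 w0, A p.1 * w0 =
          -(fderiv ℝ (slopeTrace g A G) p (G p, -((A p.1 - G p / p.1) * v1))
            - G p / p.1 * slopeTrace g A G p) →
        2 * (p.1 - q.1) * G p
          + c₀ * (A p.1 * (g p.1 - q.2) ^ 2
            - Real.exp (-μ) * (A p.1 - G p / p.1) * (p.2 - q.2) ^ 2)
          + c₁ * (A p.1 * slopeTrace g A G p ^ 2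
            - Real.exp (-μ) * (A p.1 - G p / p.1) * v1 ^ 2)
          + c₂ * (A p.1 * w0 ^ 2) ≤ -ν * (p.1 - q.1) ^ 2 := by
  obtain ⟨s, c, ρ, ν, hs, hc, hρ0, hρ1, hν, hquad⟩ := exists_lyapunov_weights hθ hA0 hgain
  set Φ := slopeTrace g A G with hΦdef
  have hΦ : AnalyticAt ℝ Φ q := analyticAt_slopeTrace hg hA hG hA0.ne'
  have hΦ0 : Φ q = 0 := by simp [hΦdef, slopeTrace, hG0]
  obtain ⟨KΦ, hKΦ, hKΦ'⟩ := eventually_sq_le_of_differentiableAt hΦ.differentiableAt hΦ0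
  obtain ⟨KG, hKG, hKG'⟩ := eventually_sq_le_of_differentiableAt hG.differentiableAt hG0
  set Ae := A q.1 with hAe
  set C : ℝ := ‖fderiv ℝ Φ q‖ + 1 with hC
  have hC0 : 0 < C := by positivity
  set K₂ : ℝ := 2 / Ae * (2 * C ^ 2 * KG + 2 * KΦ + 8 * C ^ 2 * Ae ^ 2) with hK₂
  have hK₂0 : 0 < K₂ := by positivity
  obtain ⟨μ, hμ, hμρ⟩ : ∃ μ > 0, ρ < Real.exp (-μ) := by
    refine ⟨-Real.log ((1 + ρ) / 2), ?_, ?_⟩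
    · exact neg_pos.2 (Real.log_neg (by linarith) (by linarith))
    · rw [neg_neg, Real.exp_log (by linarith)]; linarith
  set c₁ : ℝ := ν / (8 * (Ae * KΦ)) with hc₁
  have hc₁0 : 0 < c₁ := by positivity
  set c₂ : ℝ := min (ν / (4 * K₂)) (c₁ * (ρ * Ae) / K₂) with hc₂
  have hc₂0 : 0 < c₂ := lt_min (by positivity) (by positivity)
  have hAc : ContinuousAt (fun p : ℝ × ℝ => A p.1) q :=
    ContinuousAt.comp (g := A) (f := Prod.fst) hA.continuousAt continuousAt_fst
  have hBc : ContinuousAt (fun p : ℝ × ℝ => G p / p.1) q :=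
    hG.continuousAt.div continuousAt_fst hq.ne'
  have hB0 : G q / q.1 = 0 := by simp [hG0]
  have hABc : ContinuousAt (fun p : ℝ × ℝ => A p.1 - G p / p.1) q := hAc.sub hBc
  have hAB0 : A q.1 - G q / q.1 = Ae := by rw [hB0, sub_zero]
  set b : ℝ := min 1 (μ * Ae / (4 * (μ + 3))) with hb
  have hb0 : 0 < b := lt_min one_pos (by positivity)
  have evB : ∀ᶠ p in 𝓝 q, |G p / p.1| < b := by
    have : ContinuousAt (fun p : ℝ × ℝ => |G p / p.1|) q := hBc.abs
    exact this.eventually (gt_mem_nhds (by simpa [hG0] using hb0))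
  have evA : ∀ᶠ p in 𝓝 q, 3 / 4 * Ae < A p.1 :=
    hAc.eventually (lt_mem_nhds (by linarith))
  have evA2 : ∀ᶠ p in 𝓝 q, A p.1 < 2 * Ae :=
    hAc.eventually (gt_mem_nhds (by linarith))
  have evAB : ∀ᶠ p in 𝓝 q, ρ * Ae < Real.exp (-μ) * (A p.1 - G p / p.1) := by
    have h1 : ContinuousAt (fun p : ℝ × ℝ => Real.exp (-μ) * (A p.1 - G p / p.1)) q :=
      hABc.const_mul _
    exact h1.eventually (lt_mem_nhds (by simp only [hAB0]; gcongr))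
  have evAB2 : ∀ᶠ p in 𝓝 q, A p.1 - G p / p.1 < 2 * Ae :=
    hABc.eventually (gt_mem_nhds (by simp only [hAB0]; linarith))
  have evC : ∀ᶠ p in 𝓝 q, ‖fderiv ℝ Φ p‖ < C :=
    hΦ.fderiv.continuousAt.norm.eventually (gt_mem_nhds (by rw [hC]; linarith))
  have evg : ∀ᶠ p in 𝓝 q, AnalyticAt ℝ g p.1 :=
    continuousAt_fst.eventually hg.eventually_analyticAt
  have evgs : ∀ᶠ p in 𝓝 q, A p.1 * (g p.1 - q.2) ^ 2 ≤ Ae * s ^ 2 * (p.1 - q.1) ^ 2 := by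
    have := continuousAt_fst.eventually (p := fun l => A l * (g l - g q.1) ^ 2 ≤
      A q.1 * s ^ 2 * (l - q.1) ^ 2)
      (eventually_mul_sq_sub_le hg.differentiableAt.hasDerivAt hA.continuousAt hA0 hs)
    rwa [hg0] at this
  refine ⟨μ, hμ, μ * Ae / 2, by positivity, ν / 4, by positivity, c, hc, c₁, hc₁0, c₂, hc₂0, ?_⟩
  filter_upwards [hKΦ', hKG', evB, evA, evA2, evAB, evAB2, evC, evg, evgs,
    hΦ.eventually_analyticAt, eventually_mul_le_of_hasFDerivAt hG.differentiableAt.hasFDerivAt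
      hG0 (by positivity : 0 < ν / 4)] with p h1 h2 h3 h4 h5 h6 h7 h8 h9 h10 h11 h12
  set B := G p / p.1 with hB
  set a := A p.1 with ha
  have hapos : 0 < a := by linarith
  have hABpos : 0 < a - B := by
    have : 0 < Real.exp (-μ) * (a - B) := lt_trans (by positivity) h6
    exact pos_of_mul_pos_right this (Real.exp_pos _).le
  refine ⟨hapos, h9.differentiableAt, h11.differentiableAt, by linarith, ?_, ?_⟩
  · intro k hk x hx
    exact rate_le hμ h4.le (h3.le.trans (min_le_right _ _)) hk hx
  · intro v1 w0 hw
    set n := (p.1 - q.1) ^ 2 + (p.2 - q.2) ^ 2 with hn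
    have hn0 : 0 ≤ n := by positivity
    set X := fderiv ℝ Φ p (G p, -((a - B) * v1)) with hX
    have hX2 : X ^ 2 ≤ C ^ 2 * (G p ^ 2 + ((a - B) * v1) ^ 2) := by
      have e1 : ‖X‖ ≤ C * ‖(G p, -((a - B) * v1))‖ :=
        (ContinuousLinearMap.le_opNorm _ _).trans (by gcongr)
      calc X ^ 2 = ‖X‖ ^ 2 := by rw [Real.norm_eq_abs, sq_abs]
        _ ≤ (C * ‖(G p, -((a - B) * v1))‖) ^ 2 := pow_le_pow_left₀ (norm_nonneg _) e1 2
        _ = C ^ 2 * ‖(G p, -((a - B) * v1))‖ ^ 2 := mul_pow _ _ _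
        _ ≤ C ^ 2 * ((G p) ^ 2 + (-((a - B) * v1)) ^ 2) := by
          gcongr; exact sq_norm_le_add_sq _
        _ = _ := by rw [neg_sq]
    have hw2 : a * w0 ^ 2 ≤ K₂ * (n + v1 ^ 2) :=
      mul_sq_curvatureTrace_le hA0 (by linarith) (by rw [abs_of_pos hABpos]; exact h7.le)
        (h3.le.trans (min_le_left _ _)) h2 h1 hKG.le hKΦ.le hn0 hX2 hw
    have hv2 : c₁ * (a * Φ p ^ 2) ≤ ν / 4 * n := by
      calc c₁ * (a * Φ p ^ 2) ≤ c₁ * (2 * Ae * (KΦ * n)) := by gcongr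
        _ = ν / 4 * n := by rw [hc₁]; field_simp; ring
    have hw3 : c₂ * (a * w0 ^ 2) ≤ ν / 4 * n + c₁ * (ρ * Ae * v1 ^ 2) := by
      have e1 : c₂ * K₂ ≤ ν / 4 := by
        have : c₂ ≤ ν / (4 * K₂) := min_le_left _ _
        rw [le_div_iff₀ (by positivity)] at this
        linarith
      have e2 : c₂ * K₂ ≤ c₁ * (ρ * Ae) := by
        have : c₂ ≤ c₁ * (ρ * Ae) / K₂ := min_le_right _ _
        rwa [le_div_iff₀ (by positivity)] at this
      calc c₂ * (a * w0 ^ 2) ≤ c₂ * (K₂ * (n + v1 ^ 2)) := by gcongr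
        _ = c₂ * K₂ * n + c₂ * K₂ * v1 ^ 2 := by ring
        _ ≤ ν / 4 * n + c₁ * (ρ * Ae) * v1 ^ 2 := by gcongr
        _ = _ := by ring
    have hv1 : c₁ * (ρ * Ae * v1 ^ 2) ≤ c₁ * (Real.exp (-μ) * (a - B) * v1 ^ 2) := by gcongr
    have hu1 : c * (ρ * Ae * (p.2 - q.2) ^ 2) ≤
        c * (Real.exp (-μ) * (a - B) * (p.2 - q.2) ^ 2) := by gcongr
    have hg1 : c * (a * (g p.1 - q.2) ^ 2) ≤ c * (Ae * s ^ 2 * (p.1 - q.1) ^ 2) := by gcongr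
    have hq1 := hquad (p.1 - q.1) (p.2 - q.2)
    rw [← hn] at hq1
    have hn1 : (p.1 - q.1) ^ 2 ≤ n := le_add_of_nonneg_right (sq_nonneg _)
    have hn2 := mul_le_mul_of_nonneg_left hn1 (by positivity : 0 ≤ ν / 4)
    linarith

lemma continuous_section {z : ℝ → ℝ → ℝ} (hz : Continuous (Function.uncurry z)) (t : ℝ) :
    Continuous (z t) :=
  hz.comp (by fun_prop : Continuous fun x : ℝ => (t, x))

lemma differentiable_weightedEnergy {z : ℝ → ℝ → ℝ} (hz : ContDiff ℝ 1 (Function.uncurry z))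
    (μ : ℝ) : Differentiable ℝ (weightedEnergy μ z) := by
  intro t
  have h : ContDiff ℝ 1 fun p : ℝ × ℝ => Real.exp (-μ * p.2) := by fun_prop
  exact (hasDerivAt_integral_of_contDiff
    (g := fun s x => Real.exp (-μ * x) * z s x ^ 2) (h.mul (hz.pow 2)) t).differentiableAt

lemma weightedEnergy_le {z : ℝ → ℝ → ℝ} (hz : Continuous (Function.uncurry z)) {μ : ℝ}
    (hμ : 0 ≤ μ) (t : ℝ) : weightedEnergy μ z t ≤ ∫ x in (0 : ℝ)..1, z t x ^ 2 := by
  have hc := continuous_section hz t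
  refine intervalIntegral.integral_mono_on zero_le_one
    (Continuous.intervalIntegrable (by fun_prop) _ _)
    (Continuous.intervalIntegrable (by fun_prop) _ _) fun x hx => ?_
  have : Real.exp (-μ * x) ≤ 1 := by
    rw [Real.exp_le_one_iff]; nlinarith [hx.1]
  nlinarith [sq_nonneg (z t x)]

lemma le_weightedEnergy {z : ℝ → ℝ → ℝ} (hz : Continuous (Function.uncurry z)) {μ : ℝ}
    (hμ : 0 ≤ μ) (t : ℝ) :
    Real.exp (-μ) * ∫ x in (0 : ℝ)..1, z t x ^ 2 ≤ weightedEnergy μ z t := by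
  have hc := continuous_section hz t
  rw [← intervalIntegral.integral_const_mul]
  refine intervalIntegral.integral_mono_on zero_le_one
    (Continuous.intervalIntegrable (by fun_prop) _ _)
    (Continuous.intervalIntegrable (by fun_prop) _ _) fun x hx => ?_
  gcongr
  nlinarith [hx.2]

/-- The trace at `x = 0` of the space derivative of a solution. -/
lemma partialSnd_eq_slopeTrace {g A l : ℝ → ℝ} {G : ℝ × ℝ → ℝ} {f : ℝ → ℝ → ℝ} {t : ℝ}
    (ht : 0 ≤ t) (hf : ContDiff ℝ 1 (Function.uncurry f))
    (hl : HasDerivAt l (G (l t, f t 1)) t)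
    (hpde : partialFst f t 0 + A (l t) * partialSnd f t 0 = 0)
    (hbc : ∀ t, 0 ≤ t → f t 0 = g (l t)) (hA : 0 < A (l t))
    (hg : DifferentiableAt ℝ g (l t)) :
    partialSnd f t 0 = slopeTrace g A G (l t, f t 1) := by
  have h1 : HasDerivAt (fun s => g (l s)) (deriv g (l t) * G (l t, f t 1)) t :=
    hg.hasDerivAt.comp t hl
  have h2 := (hasDerivAt_partialFst hf t 0).unique_of_eventually_Ici ht h1
    (Eventually.of_forall hbc)
  rw [slopeTrace, eq_div_iff hA.ne']
  linarith

/-- Local exponential stability of a scalar equation coupled with a transport equation. -/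
theorem transport_coupled_exponential_stability {g A : ℝ → ℝ} {G : ℝ × ℝ → ℝ} {q : ℝ × ℝ}
    (hg : AnalyticAt ℝ g q.1) (hA : AnalyticAt ℝ A q.1) (hG : AnalyticAt ℝ G q)
    (hq : 0 < q.1) (hA0 : 0 < A q.1) (hg0 : g q.1 = q.2) (hG0 : G q = 0)
    (hθ : fderiv ℝ G q (1, 0) < 0)
    (hgain : |fderiv ℝ G q (0, 1) * deriv g q.1| < |fderiv ℝ G q (1, 0)|) :
    ∃ ε > (0 : ℝ), ∃ M > (0 : ℝ), ∃ ω > (0 : ℝ), ∀ (l : ℝ → ℝ) (f : ℝ → ℝ → ℝ),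
      ContDiff ℝ 3 (Function.uncurry f) →
      (∀ t, 0 ≤ t → HasDerivAt l (G (l t, f t 1)) t) →
      (∀ t, 0 ≤ t → ∀ x ∈ Icc (0 : ℝ) 1,
        partialFst f t x + (A (l t) - G (l t, f t 1) / l t * x) * partialSnd f t x = 0) →
      (∀ t, 0 ≤ t → f t 0 = g (l t)) →
      (l 0 - q.1) ^ 2 + (∫ x in (0 : ℝ)..1, ((f 0 x - q.2) ^ 2 + (deriv (f 0) x) ^ 2 +
        (iteratedDeriv 2 (f 0) x) ^ 2)) ≤ ε →
      ∀ t, 0 ≤ t →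
        (l t - q.1) ^ 2 + (∫ x in (0 : ℝ)..1, ((f t x - q.2) ^ 2 + (deriv (f t) x) ^ 2 +
          (iteratedDeriv 2 (f t) x) ^ 2)) ≤
        M * Real.exp (-ω * t) * ((l 0 - q.1) ^ 2 + ∫ x in (0 : ℝ)..1,
          ((f 0 x - q.2) ^ 2 + (deriv (f 0) x) ^ 2 + (iteratedDeriv 2 (f 0) x) ^ 2)) := by
  obtain ⟨μ, hμ, κ, hκ, ν, hν, c₀, hc₀, c₁, hc₁, c₂, hc₂, hev⟩ :=
    exists_local_dissipation hg hA hG hq hA0 hg0 hG0 hθ hgain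
  obtain ⟨r, hr, hball⟩ := Metric.eventually_nhds_iff_ball.1 hev
  set e := Real.exp (-μ) with he
  have he0 : 0 < e := Real.exp_pos _
  set m : ℝ := min 1 (e * min c₀ (min c₁ c₂)) with hm
  have hm0 : 0 < m := lt_min one_pos (mul_pos he0 (lt_min hc₀ (lt_min hc₁ hc₂)))
  have hm1 : m ≤ 1 := min_le_left _ _
  have hmc₀ : m ≤ c₀ * e := by
    rw [mul_comm]; exact (min_le_right _ _).trans (by gcongr; exact min_le_left _ _)
  have hmc₁ : m ≤ c₁ * e := by
    rw [mul_comm]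
    exact (min_le_right _ _).trans
      (by gcongr; exact (min_le_right _ _).trans (min_le_left _ _))
  have hmc₂ : m ≤ c₂ * e := by
    rw [mul_comm]
    exact (min_le_right _ _).trans
      (by gcongr; exact (min_le_right _ _).trans (min_le_right _ _))
  set δ : ℝ := m * r ^ 2 / 4 with hδ
  have hδ0 : 0 < δ := by positivity
  set M : ℝ := 1 + c₀ + c₁ + c₂ with hM
  have hM0 : 0 < M := by positivity
  set ω : ℝ := min ν κ with hω
  have hω0 : 0 < ω := lt_min hν hκ
  refine ⟨δ / (2 * M), by positivity, M / m, by positivity, ω / 2, by positivity, ?_⟩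
  intro l f hf hl hpde hbc hE0
  set u : ℝ → ℝ → ℝ := fun t x => f t x - q.2 with hu
  set v := partialSnd u with hv
  set w := partialSnd v with hw
  have hu3 : ContDiff ℝ 3 (Function.uncurry u) := hf.sub contDiff_const
  have hv2 : ContDiff ℝ 2 (Function.uncurry v) :=
    contDiff_partialSnd (n := 2) (by exact_mod_cast hu3)
  have hw1 : ContDiff ℝ 1 (Function.uncurry w) :=
    contDiff_partialSnd (n := 1) (by exact_mod_cast hv2)
  have hu1 : ContDiff ℝ 1 (Function.uncurry u) := hu3.of_le (by norm_num)
  have hf1 : ContDiff ℝ 1 (Function.uncurry f) := hf.of_le (by norm_num)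
  have hv1 : ContDiff ℝ 1 (Function.uncurry v) := hv2.of_le (by norm_num)
  have hut : partialFst u = partialFst f := by
    ext t x; simp [partialFst, hu]
  have hvf : v = partialSnd f := by
    ext t x; simp [partialSnd, hv, hu]
  have hv_deriv : ∀ t x, deriv (f t) x = v t x := fun t x => by rw [hvf]; rfl
  have hw_deriv : ∀ t x, iteratedDeriv 2 (f t) x = w t x := fun t x => by
    rw [hw, hvf, iteratedDeriv_succ, iteratedDeriv_one]; rfl
  set S : (ℝ → ℝ → ℝ) → ℝ → ℝ := fun z t => ∫ x in (0 : ℝ)..1, z t x ^ 2 with hS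
  have hEn : ∀ t, (l t - q.1) ^ 2 + (∫ x in (0 : ℝ)..1, ((f t x - q.2) ^ 2 + (deriv (f t) x) ^ 2 +
      (iteratedDeriv 2 (f t) x) ^ 2)) = (l t - q.1) ^ 2 + (S u t + S v t + S w t) := by
    intro t
    have h1 := continuous_section hu1.continuous t
    have h2 := continuous_section hv1.continuous t
    have h3 := continuous_section hw1.continuous t
    have : ∀ x, (f t x - q.2) ^ 2 + (deriv (f t) x) ^ 2 + (iteratedDeriv 2 (f t) x) ^ 2 =
        (u t x ^ 2 + v t x ^ 2) + w t x ^ 2 := fun x => by rw [hv_deriv, hw_deriv]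
    simp only [this, hS]
    rw [intervalIntegral.integral_add (Continuous.intervalIntegrable (by fun_prop) _ _)
      (Continuous.intervalIntegrable (by fun_prop) _ _),
      intervalIntegral.integral_add (Continuous.intervalIntegrable (by fun_prop) _ _)
      (Continuous.intervalIntegrable (by fun_prop) _ _)]
  rw [hEn] at hE0
  intro T hT
  rw [hEn, hEn]
  have hS0 : ∀ z t, 0 ≤ S z t := fun z t =>
    intervalIntegral.integral_nonneg zero_le_one fun x _ => sq_nonneg _
  set V : ℝ → ℝ := fun t => (l t - q.1) ^ 2 + c₀ * weightedEnergy μ u t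
    + c₁ * weightedEnergy μ v t + c₂ * weightedEnergy μ w t with hV
  have hlower : ∀ t, m * ((l t - q.1) ^ 2 + (S u t + S v t + S w t)) ≤ V t := by
    intro t
    have h1 := mul_le_mul_of_nonneg_left (le_weightedEnergy hu1.continuous hμ.le t) hc₀.le
    have h2 := mul_le_mul_of_nonneg_left (le_weightedEnergy hv1.continuous hμ.le t) hc₁.le
    have h3 := mul_le_mul_of_nonneg_left (le_weightedEnergy hw1.continuous hμ.le t) hc₂.le
    have h4 := mul_le_mul_of_nonneg_right hmc₀ (hS0 u t)
    have h5 := mul_le_mul_of_nonneg_right hmc₁ (hS0 v t)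
    have h6 := mul_le_mul_of_nonneg_right hmc₂ (hS0 w t)
    have h7 := mul_le_mul_of_nonneg_right hm1 (sq_nonneg (l t - q.1))
    simp only [hV]
    simp only [hS] at h4 h5 h6 ⊢
    linarith
  have hupper : ∀ t, V t ≤ M * ((l t - q.1) ^ 2 + (S u t + S v t + S w t)) := by
    intro t
    have h1 := mul_le_mul_of_nonneg_left (weightedEnergy_le hu1.continuous hμ.le t) hc₀.le
    have h2 := mul_le_mul_of_nonneg_left (weightedEnergy_le hv1.continuous hμ.le t) hc₁.le
    have h3 := mul_le_mul_of_nonneg_left (weightedEnergy_le hw1.continuous hμ.le t) hc₂.le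
    have hMc : c₀ ≤ M ∧ c₁ ≤ M ∧ c₂ ≤ M ∧ 1 ≤ M := by
      refine ⟨?_, ?_, ?_, ?_⟩ <;> linarith
    have h4 := mul_le_mul_of_nonneg_right hMc.1 (hS0 u t)
    have h5 := mul_le_mul_of_nonneg_right hMc.2.1 (hS0 v t)
    have h6 := mul_le_mul_of_nonneg_right hMc.2.2.1 (hS0 w t)
    have h7 := mul_le_mul_of_nonneg_right hMc.2.2.2 (sq_nonneg (l t - q.1))
    simp only [hV]
    simp only [hS] at h4 h5 h6 ⊢
    linarith
  have hVd : ∀ t, 0 ≤ t → HasDerivAt V (2 * (l t - q.1) * G (l t, f t 1)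
      + c₀ * deriv (weightedEnergy μ u) t + c₁ * deriv (weightedEnergy μ v) t
      + c₂ * deriv (weightedEnergy μ w) t) t := by
    intro t ht
    have h1 := (((hl t ht).sub_const q.1).pow 2)
    have h2 := (differentiable_weightedEnergy hu1 μ t).hasDerivAt.const_mul c₀
    have h3 := (differentiable_weightedEnergy hv1 μ t).hasDerivAt.const_mul c₁
    have h4 := (differentiable_weightedEnergy hw1 μ t).hasDerivAt.const_mul c₂
    exact (((h1.add h2).add h3).add h4).congr_deriv (by simp)
  have hnear : ∀ t, V t ≤ δ → (l t, f t 1) ∈ Metric.ball q r := by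
    intro t ht
    have h1 := hlower t
    have h2 : u t 1 ^ 2 ≤ 2 * S u t + S v t := by
      have hcu := continuous_section hu1.continuous t
      have hcv : Continuous (partialSnd u t) := continuous_section hv1.continuous t
      have := sq_le_integral_sq_add_integral_deriv_sq (fun x => hasDerivAt_partialSnd hu1 t x) hcv
      rwa [intervalIntegral.integral_add (Continuous.intervalIntegrable (by fun_prop) _ _)
        (Continuous.intervalIntegrable (by fun_prop) _ _),
        intervalIntegral.integral_const_mul] at this
    have h3 : (l t - q.1) ^ 2 + (S u t + S v t + S w t) ≤ r ^ 2 / 4 := by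
      have : m * ((l t - q.1) ^ 2 + (S u t + S v t + S w t)) ≤ m * (r ^ 2 / 4) := by
        rw [hδ] at ht; linarith
      exact le_of_mul_le_mul_left this hm0
    have h4 := hS0 u t
    have h5 := hS0 v t
    have h6 := hS0 w t
    have hr2 : 0 < r ^ 2 := by positivity
    have h7 : |l t - q.1| < r := abs_lt_of_sq_lt_sq (by linarith) hr.le
    have h8 : |f t 1 - q.2| < r :=
      abs_lt_of_sq_lt_sq (by nlinarith [sq_nonneg (l t - q.1)]) hr.le
    rw [Metric.mem_ball, Prod.dist_eq]
    exact max_lt h7 h8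
  have hdecay := exp_decay_of_deriv_le_of_le hω0 hVd
    ((mul_nonneg hm0.le (by have := hS0 u 0; have := hS0 v 0; have := hS0 w 0; positivity)).trans
      (hlower 0))
    (δ := δ) ?_ ?_ T hT
  · have h1 : m * ((l T - q.1) ^ 2 + (S u T + S v T + S w T)) ≤
        M * ((l 0 - q.1) ^ 2 + (S u 0 + S v 0 + S w 0)) * Real.exp (-(ω / 2) * T) :=
      (hlower T).trans (hdecay.trans (by gcongr; exact hupper 0))
    calc _ ≤ M * ((l 0 - q.1) ^ 2 + (S u 0 + S v 0 + S w 0)) * Real.exp (-(ω / 2) * T) / m := by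
          rw [le_div_iff₀ hm0]; linarith
      _ = _ := by ring
  · calc V 0 ≤ M * ((l 0 - q.1) ^ 2 + (S u 0 + S v 0 + S w 0)) := hupper 0
      _ ≤ M * (δ / (2 * M)) := by gcongr
      _ = δ / 2 := by field_simp
      _ < δ := by linarith
  · intro t ht hVt
    obtain ⟨hApos, hgd, hΦd, hBA, hrate, hdiss⟩ := hball _ (hnear t hVt)
    set p := (l t, f t 1) with hp
    have hp1 : p.1 = l t := rfl
    set B := G p / p.1 with hB
    have eqU : ∀ x ∈ Icc (0 : ℝ) 1,
        partialFst u t x + (A p.1 - B * x) * partialSnd u t x = 0 * B * u t x := by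
      intro x hx
      rw [← hv, hut, hvf, zero_mul, zero_mul]
      exact hpde t ht x hx
    have eqV := transport_partialSnd (hu3.of_le (by norm_num)) eqU
    have eqW := transport_partialSnd hv2 eqV
    rw [← hv] at eqV
    rw [← hw] at eqW
    obtain ⟨D0, hD0, hD0'⟩ := exists_hasDerivAt_weightedEnergy hu1 eqU
      (fun x hx => hrate _ (by norm_num) x hx)
    obtain ⟨D1, hD1, hD1'⟩ := exists_hasDerivAt_weightedEnergy hv1 eqV
      (fun x hx => hrate _ (by norm_num) x hx)
    obtain ⟨D2, hD2, hD2'⟩ := exists_hasDerivAt_weightedEnergy hw1 eqW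
      (fun x hx => hrate _ (by norm_num) x hx)
    have hv0 : ∀ s, 0 ≤ s → (l s, f s 1) ∈ Metric.ball q r →
        v s 0 = slopeTrace g A G (l s, f s 1) := by
      intro s hs hsb
      obtain ⟨hApos', hgd', -⟩ := hball _ hsb
      rw [hvf]
      refine partialSnd_eq_slopeTrace hs hf1 (hl s hs) ?_ hbc hApos' hgd'
      have := hpde s hs 0 (by norm_num)
      simpa using this
    have hpd : HasDerivAt (fun s => (l s, f s 1)) (G p, partialFst f t 1) t :=
      (hl t ht).prodMk (hasDerivAt_partialFst hf1 t 1)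
    have hft1 : partialFst f t 1 = -((A p.1 - B) * v t 1) := by
      have := eqU 1 (by norm_num)
      rw [← hv, hut] at this
      linarith
    have hvt : partialFst v t 0 =
        fderiv ℝ (slopeTrace g A G) p (G p, -((A p.1 - B) * v t 1)) := by
      have h1 : HasDerivAt (fun s => slopeTrace g A G (l s, f s 1))
          (fderiv ℝ (slopeTrace g A G) p (G p, partialFst f t 1)) t :=
        HasFDerivAt.comp_hasDerivAt (f := fun s => (l s, f s 1)) t hΦd.hasFDerivAt hpd
      rw [← hft1]
      refine (hasDerivAt_partialFst hv1 t 0).unique_of_eventually_Ici ht h1 ?_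
      filter_upwards [hpd.continuousAt.eventually (Metric.isOpen_ball.mem_nhds (hnear t hVt))]
        with s hsb hs using hv0 s hs hsb
    have hv0t : v t 0 = slopeTrace g A G p := hv0 t ht (hnear t hVt)
    have hu0t : u t 0 = g p.1 - q.2 := by simp only [hu, hbc t ht, hp1]
    have hu1t : u t 1 = p.2 - q.2 := rfl
    have hmain := hdiss (v t 1) (w t 0) (by
      have := eqV 0 (by norm_num)
      rw [← hvt, ← hv0t]
      rw [← hw] at this
      linarith)
    rw [hu0t, hu1t] at hD0'
    rw [hv0t] at hD1'
    have hW0 : ∀ z : ℝ → ℝ → ℝ, 0 ≤ weightedEnergy μ z t := fun z =>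
      intervalIntegral.integral_nonneg zero_le_one fun x _ => by positivity
    have hw1n : 0 ≤ e * (A p.1 - B) * w t 1 ^ 2 :=
      mul_nonneg (mul_nonneg he0.le (by linarith)) (sq_nonneg _)
    rw [hD0.deriv, hD1.deriv, hD2.deriv]
    have k0 := mul_le_mul_of_nonneg_left hD0' hc₀.le
    have k1 := mul_le_mul_of_nonneg_left hD1' hc₁.le
    have k2 := mul_le_mul_of_nonneg_left
      (show D2 ≤ A p.1 * w t 0 ^ 2 - κ * weightedEnergy μ w t by linarith) hc₂.le
    have hωκ : ω ≤ κ := min_le_right _ _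
    have hων : ω ≤ ν := min_le_left _ _
    have r0 := mul_le_mul_of_nonneg_right hωκ (mul_nonneg hc₀.le (hW0 u))
    have r1 := mul_le_mul_of_nonneg_right hωκ (mul_nonneg hc₁.le (hW0 v))
    have r2 := mul_le_mul_of_nonneg_right hωκ (mul_nonneg hc₂.le (hW0 w))
    have r3 := mul_le_mul_of_nonneg_right hων (sq_nonneg (l t - q.1))
    rw [hp1] at *
    simp only [hV]
    linarith

/-- Screw speed generated by the feedback law, as a function of the interface position. -/
noncomputable def feedbackSpeed (Q : ℝ → ℝ) (k D Ne : ℝ) (l : ℝ) : ℝ := Ne * D / (1 - k * Q l)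

/-- Inlet filling ratio generated by the feedback law, as a function of the interface position. -/
noncomputable def inletRatio (Q n : ℝ → ℝ) (c fpe k Ne b : ℝ) (l : ℝ) : ℝ :=
  (c * Ne * fpe + k * (n l * Q l - Ne * b)) / (c * n l)

lemma analyticAt_qfun {L B Kd η ρ0 Veff l : ℝ} (h : B * ρ0 + Kd * (L - l) ≠ 0) :
    AnalyticAt ℝ (qfun η ρ0 Veff L B Kd) l := by
  unfold qfun
  fun_prop (disch := exact h)

lemma hasDerivAt_feedbackSpeed {Q : ℝ → ℝ} {Q' k D Ne l : ℝ} (hQ : HasDerivAt Q Q' l)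
    (hD : D = 1 - k * Q l) (hD0 : D ≠ 0) :
    HasDerivAt (feedbackSpeed Q k D Ne) (Ne * k * Q' / D) l := by
  have h := (hasDerivAt_const l (Ne * D)).div ((hQ.const_mul k).const_sub 1) (hD ▸ hD0)
  refine h.congr_deriv ?_
  rw [← hD]
  field_simp
  ring

lemma hasDerivAt_inletRatio {Q n : ℝ → ℝ} {Q' n' c fpe k k' D Ne b l : ℝ}
    (hQ : HasDerivAt Q Q' l) (hn : HasDerivAt n n' l) (hb : Q l = b) (hnl : n l = Ne)
    (hn' : n' = Ne * k' * Q' / D) (hD : D = 1 - k' * b) (hD0 : D ≠ 0) (hc : c ≠ 0)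
    (hNe : Ne ≠ 0) :
    HasDerivAt (inletRatio Q n c fpe k Ne b)
      (Ne * Q' * (k - fpe * c * k') / (c * Ne * D)) l := by
  have h := (((hn.mul hQ).sub_const (Ne * b)).const_mul k |>.const_add (c * Ne * fpe)).div
    (hn.const_mul c) (by rw [hnl]; exact mul_ne_zero hc hNe)
  refine h.congr_deriv ?_
  simp only [Pi.mul_apply, hb, hnl, hn']
  have hk : k' * b = 1 - D := by linarith
  field_simp
  linear_combination k * Q' * hk

/-- under the stabilizability conditions on the gains `k1, k2`, the
closed-loop extrusion model is locally exponentially stable: there are `ε, M, ω > 0` such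
that every classical solution `(l, f)` (with the feedback screw speed `N`, inlet flow rate
`Fi` and die pressure difference `ΔP`) whose initial energy
`E(0) = |l(0) − le|² + ∫₀¹ [(f(0,x) − fpe)² + (∂ₓf(0,x))² + (∂ₓ²f(0,x))²] dx` is at most
`ε` satisfies `E(t) ≤ M·e^{−ωt}·E(0)` for all `t ≥ 0`. -/
theorem extrusion_exponential_stabilization
    (L B Kd ζ η ρ0 Seff Veff : ℝ)
    (hL : 0 < L) (hB : 0 < B) (hKd : 0 < Kd) (hζ : 0 < ζ) (hη : 0 < η)
    (hρ0 : 0 < ρ0) (hSeff : 0 < Seff) (hVeff : 0 < Veff)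
    (le fpe Ne : ℝ)
    (hle : le ∈ Set.Ioo 0 L) (hfpe : fpe ∈ Set.Ioo (0:ℝ) 1) (hNe : 0 < Ne)
    (heq : (Kd / η) * Ne * qfun η ρ0 Veff L B Kd le = ρ0 * Veff * Ne * fpe)
    (a1 a2 a3 b1 b2 : ℝ)
    (ha1 : a1 = deriv (fun s => Ffun η ρ0 Veff Seff L B Kd s Ne fpe) le)
    (ha2 : a2 = deriv (fun s => Ffun η ρ0 Veff Seff L B Kd le s fpe) Ne)
    (ha3 : a3 = deriv (fun s => Ffun η ρ0 Veff Seff L B Kd le Ne s) fpe)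
    (hb1 : b1 = Ne * deriv (qfun η ρ0 Veff L B Kd) le)
    (hb2 : b2 = qfun η ρ0 Veff L B Kd le)
    (k1 k2 : ℝ)
    (hden : 1 - k1 * b2 ≠ 0)
    (hθ0 : a1 + k1 * a2 * b1 / (1 - k1 * b2) < 0)
    (hgain : |a3 * b1 * (k2 - fpe * ρ0 * Veff * k1) / (ρ0 * Veff * Ne * (1 - k1 * b2))| <
        |a1 + k1 * a2 * b1 / (1 - k1 * b2)|) :
    ∃ ε > (0:ℝ), ∃ M > (0:ℝ), ∃ ω > (0:ℝ),
      ∀ (l : ℝ → ℝ) (f : ℝ → ℝ → ℝ) (N Fi ΔP : ℝ → ℝ),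
        -- regularity: l is C¹ and f is C³
        ContDiff ℝ 1 l →
        ContDiff ℝ 3 (Function.uncurry f) →
        -- state constraints
        (∀ t, 0 ≤ t → l t ∈ Set.Ioo 0 L) →
        (∀ t, 0 ≤ t → ∀ x ∈ Set.Icc (0:ℝ) 1, f t x < 1) →
        -- die pressure difference and feedback controls
        (∀ t, 0 ≤ t → ΔP t = N t * qfun η ρ0 Veff L B Kd (l t)) →
        (∀ t, 0 ≤ t → N t = Ne + k1 * (ΔP t - Ne * qfun η ρ0 Veff L B Kd le)) →
        (∀ t, 0 ≤ t → 0 < N t) →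
        (∀ t, 0 ≤ t →
          Fi t = ρ0 * Veff * Ne * fpe + k2 * (ΔP t - Ne * qfun η ρ0 Veff L B Kd le)) →
        -- interface dynamics
        (∀ t, 0 ≤ t → HasDerivAt l
          (((Kd / η) * ΔP t - ρ0 * Veff * N t * f t 1) / (ρ0 * Seff * (1 - f t 1))) t) →
        -- transport equation with normalized speed α(t,x) = (ζ·N(t) − x·l'(t))/l(t)
        (∀ t, 0 ≤ t → ∀ x ∈ Set.Icc (0:ℝ) 1,
          deriv (fun s => f s x) t
            + ((ζ * N t - x * deriv l t) / l t) * deriv (f t) x = 0) →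
        -- boundary condition
        (∀ t, 0 ≤ t → f t 0 = Fi t / (ρ0 * Veff * N t)) →
        -- smallness of the initial energy
        (l 0 - le) ^ 2 + (∫ x in (0:ℝ)..1,
            ((f 0 x - fpe) ^ 2 + (deriv (f 0) x) ^ 2 + (iteratedDeriv 2 (f 0) x) ^ 2)) ≤ ε →
        -- exponential decay of the energy
        ∀ t, 0 ≤ t →
          (l t - le) ^ 2 + (∫ x in (0:ℝ)..1,
              ((f t x - fpe) ^ 2 + (deriv (f t) x) ^ 2 + (iteratedDeriv 2 (f t) x) ^ 2)) ≤
            M * Real.exp (-ω * t) *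
              ((l 0 - le) ^ 2 + ∫ x in (0:ℝ)..1,
                ((f 0 x - fpe) ^ 2 + (deriv (f 0) x) ^ 2 + (iteratedDeriv 2 (f 0) x) ^ 2)) := by
  set Q := qfun η ρ0 Veff L B Kd with hQdef
  set D := 1 - k1 * b2 with hD
  set n := feedbackSpeed Q k1 D Ne with hn
  set g := inletRatio Q n (ρ0 * Veff) fpe k2 Ne b2 with hg
  set G : ℝ × ℝ → ℝ := fun p => Ffun η ρ0 Veff Seff L B Kd p.1 (n p.1) p.2 with hG
  set A : ℝ → ℝ := fun l => ζ * n l / l with hA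
  have hc : 0 < ρ0 * Veff := mul_pos hρ0 hVeff
  have hfp : 0 < 1 - fpe := by linarith [hfpe.2]
  have hle0 : 0 < le := hle.1
  have hden' : B * ρ0 + Kd * (L - le) ≠ 0 := by
    have := mul_pos hKd (sub_pos.2 hle.2)
    positivity
  have hQa : AnalyticAt ℝ Q le := analyticAt_qfun hden'
  have hQ' := hQa.differentiableAt.hasDerivAt
  have hD' : D = 1 - k1 * Q le := by rw [hD, hb2]
  have hna : AnalyticAt ℝ n le :=
    analyticAt_const.div (analyticAt_const.sub (analyticAt_const.mul hQa)) (hD' ▸ hden)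
  have hnle : n le = Ne := by
    simp only [hn, feedbackSpeed]
    rw [← hD', mul_div_cancel_right₀ _ hden]
  have hn' := hasDerivAt_feedbackSpeed (Ne := Ne) hQ' hD' hden
  have hg' : HasDerivAt g _ le :=
    hasDerivAt_inletRatio (fpe := fpe) (k := k2) hQ' hn' hb2.symm hnle rfl hD hden hc.ne' hNe.ne'
  have hga : AnalyticAt ℝ g le :=
    (analyticAt_const.add (analyticAt_const.mul ((hna.mul hQa).sub analyticAt_const))).div
      (analyticAt_const.mul hna) (by rw [hnle]; positivity)
  have hAa : AnalyticAt ℝ A le := (analyticAt_const.mul hna).div analyticAt_id hle0.ne'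
  have hGa : AnalyticAt ℝ G (le, fpe) := by
    have h1 : AnalyticAt ℝ (fun p : ℝ × ℝ => n p.1) (le, fpe) :=
      AnalyticAt.fun_comp (g := n) hna analyticAt_fst
    have h2 : AnalyticAt ℝ (fun p : ℝ × ℝ => Q p.1) (le, fpe) :=
      AnalyticAt.fun_comp (g := Q) hQa analyticAt_fst
    exact (((analyticAt_const.mul h1).mul h2).sub
      ((analyticAt_const.mul h1).mul analyticAt_snd)).div
      (analyticAt_const.mul (analyticAt_const.sub analyticAt_snd)) (by positivity)
  have hG0 : G (le, fpe) = 0 := by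
    simp only [hG, Ffun, hnle]
    rw [heq, sub_self, zero_div]
  have hg0 : g le = fpe := by
    simp only [hg, inletRatio, hnle, hb2, sub_self, mul_zero, add_zero]
    field_simp
  have hGd := hGa.differentiableAt.hasFDerivAt
  have hG2 : fderiv ℝ G (le, fpe) (0, 1) = a3 := by
    have h := hGd.comp_hasDerivAt fpe ((hasDerivAt_const fpe le).prodMk (hasDerivAt_id fpe))
    rw [ha3, ← h.deriv]
    simp only [hG, Function.comp_def, hnle]
  have hK0 : Kd / η * Q le - ρ0 * Veff * fpe = 0 := by
    have : Ne * (Kd / η * Q le - ρ0 * Veff * fpe) = 0 := by linear_combination heq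
    exact (mul_eq_zero.1 this).resolve_left hNe.ne'
  have hK : HasDerivAt (fun s => (Kd / η * Q s - ρ0 * Veff * fpe) / (ρ0 * Seff * (1 - fpe)))
      (Kd / η * deriv Q le / (ρ0 * Seff * (1 - fpe))) le :=
    ((hQ'.const_mul (Kd / η)).sub_const _).div_const _
  have hF : ∀ s N, Ffun η ρ0 Veff Seff L B Kd s N fpe =
      N * ((Kd / η * Q s - ρ0 * Veff * fpe) / (ρ0 * Seff * (1 - fpe))) := by
    intro s N
    simp only [Ffun, ← hQdef]
    ring
  have ha2' : a2 = 0 := by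
    rw [ha2]
    simp [hF, hK0]
  have ha1' : a1 = Ne * (Kd / η * deriv Q le / (ρ0 * Seff * (1 - fpe))) := by
    rw [ha1]
    simp only [hF]
    exact (hK.const_mul Ne).deriv
  have hG1 : fderiv ℝ G (le, fpe) (1, 0) = a1 := by
    have h := hGd.comp_hasDerivAt le ((hasDerivAt_id le).prodMk (hasDerivAt_const le fpe))
    have h' := hn'.mul hK
    rw [← h.deriv, ha1']
    refine Eq.trans ?_ (h'.congr_deriv (by rw [← hn, hnle, hK0]; ring) :
      HasDerivAt _ (Ne * (Kd / η * deriv Q le / (ρ0 * Seff * (1 - fpe)))) le).deriv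
    congr 1
    ext s
    simp only [hG, Function.comp_def, id, hF, Pi.mul_apply]
    rfl
  have hθ : a1 + k1 * a2 * b1 / D = a1 := by rw [ha2']; simp
  rw [hθ] at hθ0 hgain
  obtain ⟨ε, hε, M, hM, ω, hω, hmain⟩ := transport_coupled_exponential_stability
    (q := (le, fpe)) hga hAa hGa hle0 (by simp only [hA, hnle]; positivity) hg0 hG0
    (by rw [hG1]; exact hθ0) (by
      rw [hG1, hG2, hg'.deriv]
      refine lt_of_eq_of_lt ?_ hgain
      rw [hb1]
      congr 1
      ring)
  refine ⟨ε, hε, M, hM, ω, hω, ?_⟩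
  intro l f N Fi ΔP _ hf _ _ hΔ hN hNpos hFi hl hpde hbc
  have hNn : ∀ t, 0 ≤ t → N t = n (l t) := by
    intro t ht
    have h1 : N t * (1 - k1 * Q (l t)) = Ne * D := by
      have h2 := hN t ht
      rw [hΔ t ht, ← hb2] at h2
      rw [hD]
      linear_combination h2
    have h3 : 1 - k1 * Q (l t) ≠ 0 := by
      intro h
      rw [h, mul_zero] at h1
      exact mul_ne_zero hNe.ne' hden h1.symm
    simp only [hn, feedbackSpeed]
    rw [eq_div_iff h3, h1]
  have hlG : ∀ t, 0 ≤ t → HasDerivAt l (G (l t, f t 1)) t := by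
    intro t ht
    refine (hl t ht).congr_deriv ?_
    simp only [hG, Ffun, ← hQdef]
    rw [hΔ t ht, ← hNn t ht, mul_assoc (Kd / η)]
  refine hmain l f hf hlG ?_ ?_
  · intro t ht x hx
    have h1 := hpde t ht x hx
    rw [(hlG t ht).deriv, hNn t ht] at h1
    rw [← h1]
    simp only [partialFst, partialSnd, hA]
    ring
  · intro t ht
    rw [hbc t ht, hFi t ht, hΔ t ht, hNn t ht, ← hb2]
    rfl
end

section
/- Suppose the gains k1, k2 ∈ ℝ satisfy: 1 − k1·b2 ≠ 0, θ0 := a1 + k1·a2·b1/(1 − k1·b2) < 0, and |a3·b1·(k2 − fpe·ρ0·Veff·k1)/(ρ0·Veff·Ne·(1 − k1·b2))| < |θ0|, where a1, a2, a3 are the partial derivatives of F with respect to l, N, fp at (le, Ne, fpe) and b1 = Ne·q'(le), b2 = q(le). Then there exist positive constants A1, γ1, β0, β1, δ1 and δ such that for every classical solution (l, f) of the normalized closed-loop extrusion model on [0,∞) and every time t ≥ 0 at which |l(t) − le| + |N(t) − Ne| + |f(t,1) − fpe| ≤ δ, the quantity V(t) := (l(t) − le)² + A1·∫₀¹ e^{−γ1·x}·(f(t,x)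 − fpe)² dx is differentiable and satisfies V'(t) ≤ −β0·(l(t) − le)² − β1·∫₀¹ e^{−γ1·x}·(f(t,x) − fpe)² dx − δ1·(f(t,1) − fpe)². -/
/-- Differentiation under the integral sign for a jointly `C¹` integrand on a compact interval. -/
theorem hasDerivAt_intervalIntegral_of_contDiff {F : ℝ → ℝ → ℝ}
    (hF : ContDiff ℝ 1 (Function.uncurry F)) (a b t : ℝ) :
    HasDerivAt (fun s => ∫ x in a..b, F s x) (∫ x in a..b, deriv (fun s => F s x) t) t := by
  have hdiff : ∀ s x, HasDerivAt (fun s => F s x)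
      (fderiv ℝ (Function.uncurry F) (s, x) (1, 0)) s := fun s x =>
    HasFDerivAt.comp_hasDerivAt (f := fun s => (s, x)) s
      (hF.differentiable one_ne_zero (s, x)).hasFDerivAt
      ((hasDerivAt_id s).prodMk (hasDerivAt_const s x))
  have hcont : Continuous fun p : ℝ × ℝ => fderiv ℝ (Function.uncurry F) p (1, 0) :=
    (hF.continuous_fderiv one_ne_zero).clm_apply continuous_const
  obtain ⟨C, hC⟩ := ((isCompact_Icc (a := t - 1) (b := t + 1)).prod
    (isCompact_uIcc (a := a) (b := b))).exists_bound_of_continuousOn hcont.continuousOn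
  have hcF : ∀ s, Continuous (F s) := fun s =>
    hF.continuous.comp (continuous_const.prodMk continuous_id)
  have key := (intervalIntegral.hasDerivAt_integral_of_dominated_loc_of_deriv_le
    (μ := MeasureTheory.volume) (a := a) (b := b) (F := F) (x₀ := t)
    (F' := fun s x => fderiv ℝ (Function.uncurry F) (s, x) (1, 0)) (bound := fun _ => C)
    (Icc_mem_nhds (by linarith : t - 1 < t) (by linarith : t < t + 1))
    (Filter.Eventually.of_forall fun s => (hcF s).aestronglyMeasurable)
    ((hcF t).intervalIntegrable a b)
    (hcont.comp (continuous_const.prodMk continuous_id)).aestronglyMeasurable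
    (Filter.Eventually.of_forall fun x hx s hs =>
      hC (s, x) ⟨hs, Set.uIoc_subset_uIcc hx⟩)
    intervalIntegrable_const
    (Filter.Eventually.of_forall fun x _ s _ => hdiff s x)).2
  simpa only [(hdiff _ _).deriv] using key

/-- Dissipation of the exponentially weighted `L²` energy of a solution of the transport equation
with affine speed `x ↦ a - x * b`. -/
theorem weighted_energy_decay_of_transport {f : ℝ → ℝ → ℝ}
    (hf : ContDiff ℝ 1 (Function.uncurry f)) {γ c t a b κ : ℝ}
    (hpde : ∀ x ∈ Set.Icc (0 : ℝ) 1,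
      deriv (fun s => f s x) t + (a - x * b) * deriv (f t) x = 0)
    (hκ : ∀ x ∈ Set.Icc (0 : ℝ) 1, κ ≤ γ * (a - x * b) + b) :
    ∃ D : ℝ, HasDerivAt (fun s => ∫ x in (0 : ℝ)..1, Real.exp (-γ * x) * (f s x - c) ^ 2) D t ∧
      D ≤ a * (f t 0 - c) ^ 2 - Real.exp (-γ) * (a - b) * (f t 1 - c) ^ 2
        - κ * ∫ x in (0 : ℝ)..1, Real.exp (-γ * x) * (f t x - c) ^ 2 := by
  have hFc : ContDiff ℝ 1
      (Function.uncurry fun s x => Real.exp (-γ * x) * (f s x - c) ^ 2) := by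
    change ContDiff ℝ 1
      (fun p : ℝ × ℝ => Real.exp (-γ * p.2) * (Function.uncurry f p - c) ^ 2)
    fun_prop
  refine ⟨_, hasDerivAt_intervalIntegral_of_contDiff hFc 0 1 t, ?_⟩
  have hft : ContDiff ℝ 1 (f t) := hf.comp (contDiff_const.prodMk contDiff_id)
  have hfx : ∀ x, HasDerivAt (f t) (deriv (f t) x) x := fun x =>
    (hft.differentiable one_ne_zero x).hasDerivAt
  have hfs : ∀ x, HasDerivAt (fun s => f s x) (deriv (fun s => f s x) t) t := fun x =>
    (((hf.comp (contDiff_id.prodMk contDiff_const) :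
      ContDiff ℝ 1 fun s => f s x)).differentiable one_ne_zero t).hasDerivAt
  have hcont : Continuous (f t) := hft.continuous
  have hcont' : Continuous (deriv (f t)) := hft.continuous_deriv le_rfl
  set G : ℝ → ℝ := fun x =>
    Real.exp (-γ * x) * (-γ * (a - x * b) - b) * (f t x - c) ^ 2
      + Real.exp (-γ * x) * (a - x * b) * (2 * (f t x - c) * deriv (f t) x) with hG
  have hGc : Continuous G := by fun_prop
  have hftc : ∫ x in (0 : ℝ)..1, G x =
      Real.exp (-γ) * (a - b) * (f t 1 - c) ^ 2 - a * (f t 0 - c) ^ 2 := by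
    rw [intervalIntegral.integral_eq_sub_of_hasDerivAt
      (f := fun x => Real.exp (-γ * x) * (a - x * b) * (f t x - c) ^ 2) (fun x _ => ?_)
      (hGc.intervalIntegrable 0 1)]
    · simp
    · have h1 : HasDerivAt (fun x => Real.exp (-γ * x)) (Real.exp (-γ * x) * (-γ)) x := by
        simpa using ((hasDerivAt_id x).const_mul (-γ)).exp
      have h2 : HasDerivAt (fun x => a - x * b) (-b) x := by
        simpa using ((hasDerivAt_id x).mul_const b).const_sub a
      have h3 := ((hfx x).sub_const c).fun_pow 2
      refine ((h1.mul h2).mul h3).congr_deriv ?_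
      simp only [hG, Nat.cast_ofNat, Nat.add_one_sub_one, pow_one, Pi.mul_apply]
      ring
  have hint : IntervalIntegrable (fun x => Real.exp (-γ * x) * (f t x - c) ^ 2)
      MeasureTheory.volume 0 1 :=
    (Continuous.intervalIntegrable (by fun_prop) 0 1)
  have hle : ∫ x in (0 : ℝ)..1,
        deriv (fun s => Real.exp (-γ * x) * (f s x - c) ^ 2) t ≤
      ∫ x in (0 : ℝ)..1, (-κ * (Real.exp (-γ * x) * (f t x - c) ^ 2) - G x) := by
    have hderiv : Set.EqOn (fun x => deriv (fun s => Real.exp (-γ * x) * (f s x - c) ^ 2) t)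
        (fun x => Real.exp (-γ * x) *
          (2 * (f t x - c) * (-((a - x * b) * deriv (f t) x)))) (Set.uIcc 0 1) := by
      intro x hx
      rw [Set.uIcc_of_le zero_le_one] at hx
      have h := ((((hfs x).sub_const c).pow 2).const_mul (Real.exp (-γ * x))).deriv
      have hp : deriv (fun s => f s x) t = -((a - x * b) * deriv (f t) x) := by
        linarith [hpde x hx]
      simp only [hp] at h
      refine h.trans ?_
      simp
    rw [intervalIntegral.integral_congr hderiv]
    refine intervalIntegral.integral_mono_on zero_le_one
      (Continuous.intervalIntegrable (by fun_prop) 0 1)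
      (Continuous.intervalIntegrable (by fun_prop) 0 1) fun x hx => ?_
    have hpos : 0 ≤ Real.exp (-γ * x) * (f t x - c) ^ 2 := by positivity
    have := mul_le_mul_of_nonneg_right (hκ x hx) hpos
    simp only [hG]
    linarith
  rw [intervalIntegral.integral_sub (hint.const_mul _) (hGc.intervalIntegrable 0 1),
    intervalIntegral.integral_const_mul, hftc] at hle
  linarith

/-- A coupling smaller than the decay rate admits a weight making the quadratic form of the
cascade negative definite. -/
theorem exists_weight_quadratic_form_neg {θ a θ1 : ℝ} (hθ : θ < 0) (h : |a * θ1| < |θ|) :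
    ∃ A > (0 : ℝ), ∃ γ > (0 : ℝ), ∃ c > (0 : ℝ), ∀ y w : ℝ,
      2 * y * (θ * y + a * w) + A * ((θ1 * y) ^ 2 - Real.exp (-γ) * w ^ 2)
        ≤ -c * (y ^ 2 + w ^ 2) := by
  have hsq : (a * θ1) ^ 2 < θ ^ 2 := sq_lt_sq.2 h
  obtain ⟨A, hA, hm, hdet⟩ : ∃ A > (0 : ℝ), 0 < -2 * θ - A * θ1 ^ 2 ∧
      a ^ 2 < (-2 * θ - A * θ1 ^ 2) * A := by
    rcases eq_or_ne θ1 0 with h0 | h0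
    · refine ⟨(a ^ 2 + 1) / -θ, div_pos (by positivity) (by linarith), ?_, ?_⟩
      · rw [h0]; linarith
      · rw [h0]
        have : (-2 * θ - (a ^ 2 + 1) / -θ * 0 ^ 2) * ((a ^ 2 + 1) / -θ) = 2 * (a ^ 2 + 1) := by
          have := hθ.ne
          field_simp
          ring
        rw [this]
        nlinarith [sq_nonneg a]
    · have hp : 0 < θ1 ^ 2 := by positivity
      refine ⟨-θ / θ1 ^ 2, div_pos (by linarith) hp, ?_, ?_⟩
      · rw [div_mul_cancel₀ _ hp.ne']; linarith
      · rw [div_mul_cancel₀ _ hp.ne', ← mul_div_assoc, lt_div_iff₀ hp]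
        nlinarith
  set m := -2 * θ - A * θ1 ^ 2 with hmdef
  obtain ⟨γ, hγ, hγdet⟩ : ∃ γ > (0 : ℝ), a ^ 2 < m * A * Real.exp (-γ) := by
    have hc : Filter.Tendsto (fun γ : ℝ => m * A * Real.exp (-γ)) (nhdsWithin 0 (Set.Ioi 0))
        (nhds (m * A)) := by
      have : Continuous fun γ : ℝ => m * A * Real.exp (-γ) := by fun_prop
      simpa using (this.tendsto 0).mono_left nhdsWithin_le_nhds
    obtain ⟨γ, h1, h2⟩ := ((hc.eventually (lt_mem_nhds hdet)).and self_mem_nhdsWithin).exists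
    exact ⟨γ, h2, h1⟩
  set n := A * Real.exp (-γ) with hn
  have hnpos : 0 < n := mul_pos hA (Real.exp_pos _)
  have hmn : 0 < m * n - a ^ 2 := by rw [hn]; linarith
  set c := (m * n - a ^ 2) / (m + n) with hc
  have hcpos : 0 < c := div_pos hmn (by linarith)
  have hcmul : c * (m + n) = m * n - a ^ 2 := div_mul_cancel₀ _ (by linarith)
  refine ⟨A, hA, γ, hγ, c, hcpos, fun y w => ?_⟩
  have hmc : 0 < m - c := by
    have : (m - c) * (m + n) = m ^ 2 + a ^ 2 := by linear_combination -hcmul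
    have h2 : 0 < (m - c) * (m + n) := by rw [this]; positivity
    exact pos_of_mul_pos_left h2 (by linarith)
  have hform : 0 ≤ (m - c) * y ^ 2 - 2 * a * y * w + (n - c) * w ^ 2 := by
    refine nonneg_of_mul_nonneg_right ?_ hmc
    have : (m - c) * ((m - c) * y ^ 2 - 2 * a * y * w + (n - c) * w ^ 2)
        = ((m - c) * y - a * w) ^ 2 + (c * w) ^ 2 := by
      linear_combination -w ^ 2 * hcmul
    rw [this]
    positivity
  have : 2 * y * (θ * y + a * w) + A * ((θ1 * y) ^ 2 - Real.exp (-γ) * w ^ 2)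
      = -m * y ^ 2 + 2 * a * y * w - n * w ^ 2 := by
    rw [hmdef, hn]; ring
  linarith

/-- Robustness of the negative definite quadratic form under small perturbations of the
linearized dynamics, the boundary value and the transport speeds. -/
theorem exists_perturbation_margin {θ a θ1 A α0 γ c : ℝ} (hA : 0 < A) (hα : 0 < α0) (hγ : 0 < γ)
    (hc : 0 < c)
    (h : ∀ y w : ℝ, 2 * y * (θ * y + a * w) + A * ((θ1 * y) ^ 2 - Real.exp (-γ) * w ^ 2)
        ≤ -c * (y ^ 2 + w ^ 2)) :
    ∃ ε > (0 : ℝ), ∀ y w v z p r : ℝ, |v - (θ * y + a * w)| ≤ ε * (|y| + |w|) →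
      |z - θ1 * y| ≤ ε * |y| → |p - α0| ≤ ε → |r - α0| ≤ ε →
      2 * y * v + A / α0 * (p * z ^ 2 - Real.exp (-γ) * r * w ^ 2)
        ≤ -(c / 2) * (y ^ 2 + w ^ 2) := by
  set A1 := A / α0 with hA1
  have hA1pos : 0 < A1 := div_pos hA hα
  have hA1α : A1 * α0 = A := div_mul_cancel₀ _ hα.ne'
  set K := 3 + A1 * (α0 * (2 * |θ1| + 1) + (|θ1| + 1) ^ 2 + 1) with hK
  have hKpos : 0 < K := by positivity
  refine ⟨min 1 (c / (2 * K)), by positivity, ?_⟩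
  set ε := min 1 (c / (2 * K)) with hε
  have hεpos : 0 < ε := by positivity
  have hε1 : ε ≤ 1 := min_le_left _ _
  have hεK : ε * K ≤ c / 2 := by
    have : ε ≤ c / (2 * K) := min_le_right _ _
    rw [le_div_iff₀ (by positivity)] at this
    linarith
  intro y w v z p r hv hz hp hr
  have hv' : 2 * y * v ≤ 2 * y * (θ * y + a * w) + 3 * ε * (y ^ 2 + w ^ 2) := by
    have h1 : y * (v - (θ * y + a * w)) ≤ |y| * (ε * (|y| + |w|)) :=
      (le_abs_self _).trans (by rw [abs_mul]; gcongr)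
    have h2 : |y| * (|y| + |w|) ≤ 3 / 2 * (y ^ 2 + w ^ 2) := by
      rw [← sq_abs y, ← sq_abs w]
      linarith [sq_nonneg (|y| - |w|), sq_nonneg (|w|), sq_nonneg (|y|)]
    linarith [mul_le_mul_of_nonneg_left h2 hεpos.le]
  have hzabs : |z| ≤ (|θ1| + ε) * |y| := by
    have : |z| ≤ |z - θ1 * y| + |θ1 * y| := by
      simpa using abs_add_le (z - θ1 * y) (θ1 * y)
    rw [abs_mul] at this
    linarith
  have hzsq : z ^ 2 ≤ (|θ1| + ε) ^ 2 * y ^ 2 := by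
    rw [← sq_abs z, ← sq_abs y, ← mul_pow]
    gcongr
  have hz1 : z ^ 2 ≤ (θ1 * y) ^ 2 + ε * (2 * |θ1| + 1) * y ^ 2 := by
    have : (|θ1| + ε) ^ 2 ≤ θ1 ^ 2 + ε * (2 * |θ1| + 1) := by
      rw [← sq_abs θ1]
      linarith [mul_le_mul_of_nonneg_left hε1 hεpos.le]
    linarith [mul_le_mul_of_nonneg_right this (sq_nonneg y)]
  have hz2 : z ^ 2 ≤ (|θ1| + 1) ^ 2 * y ^ 2 := hzsq.trans (by gcongr)
  have hpz : p * z ^ 2 ≤ α0 * (θ1 * y) ^ 2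
      + ε * (α0 * (2 * |θ1| + 1) + (|θ1| + 1) ^ 2) * y ^ 2 := by
    have h1 : p ≤ α0 + ε := by linarith [(abs_le.1 hp).2]
    have h2 : p * z ^ 2 ≤ (α0 + ε) * z ^ 2 := by gcongr
    have h3 := mul_le_mul_of_nonneg_left hz1 hα.le
    have h4 := mul_le_mul_of_nonneg_left hz2 hεpos.le
    linarith
  have hrw : -(Real.exp (-γ) * r * w ^ 2) ≤ -(Real.exp (-γ) * α0 * w ^ 2) + ε * w ^ 2 := by
    have h1 : α0 - r ≤ ε := by linarith [(abs_le.1 hr).1]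
    have h2 : Real.exp (-γ) ≤ 1 := Real.exp_le_one_iff.2 (by linarith)
    have h3 : Real.exp (-γ) * (α0 - r) ≤ ε :=
      (mul_le_mul_of_nonneg_left h1 (Real.exp_pos _).le).trans (by nlinarith)
    linarith [mul_le_mul_of_nonneg_right h3 (sq_nonneg w)]
  have hB : p * z ^ 2 - Real.exp (-γ) * r * w ^ 2 ≤
      α0 * ((θ1 * y) ^ 2 - Real.exp (-γ) * w ^ 2)
        + ε * (α0 * (2 * |θ1| + 1) + (|θ1| + 1) ^ 2 + 1) * (y ^ 2 + w ^ 2) := by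
    have : 0 ≤ ε * (α0 * (2 * |θ1| + 1) + (|θ1| + 1) ^ 2) * w ^ 2 := by positivity
    linarith [mul_nonneg hεpos.le (sq_nonneg y)]
  have hB' := mul_le_mul_of_nonneg_left hB hA1pos.le
  have hq := h y w
  have hKm : ε * K * (y ^ 2 + w ^ 2) ≤ c / 2 * (y ^ 2 + w ^ 2) := by gcongr
  have e1 : A1 * (α0 * ((θ1 * y) ^ 2 - Real.exp (-γ) * w ^ 2)
        + ε * (α0 * (2 * |θ1| + 1) + (|θ1| + 1) ^ 2 + 1) * (y ^ 2 + w ^ 2))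
      = A * ((θ1 * y) ^ 2 - Real.exp (-γ) * w ^ 2) + ε * K * (y ^ 2 + w ^ 2)
        - 3 * ε * (y ^ 2 + w ^ 2) := by
    rw [← hA1α, hK]; ring
  linarith

/-- First-order expansion of a function of two real variables in terms of its partial
derivatives. -/
theorem eventually_abs_sub_partial_le {G : ℝ × ℝ → ℝ} {x₀ y₀ g₁ g₂ ε : ℝ}
    (hG : DifferentiableAt ℝ G (x₀, y₀)) (h₁ : HasDerivAt (fun s => G (s, y₀)) g₁ x₀)
    (h₂ : HasDerivAt (fun s => G (x₀, s)) g₂ y₀) (hε : 0 < ε) :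
    ∀ᶠ p in nhds (x₀, y₀), |G p - G (x₀, y₀) - (g₁ * (p.1 - x₀) + g₂ * (p.2 - y₀))|
      ≤ ε * (|p.1 - x₀| + |p.2 - y₀|) := by
  have e₁ : fderiv ℝ G (x₀, y₀) (1, 0) = g₁ :=
    (HasFDerivAt.comp_hasDerivAt (f := fun s => (s, y₀)) x₀ hG.hasFDerivAt
      ((hasDerivAt_id x₀).prodMk (hasDerivAt_const x₀ y₀))).unique h₁
  have e₂ : fderiv ℝ G (x₀, y₀) (0, 1) = g₂ :=
    (HasFDerivAt.comp_hasDerivAt (f := fun s => (x₀, s)) y₀ hG.hasFDerivAt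
      ((hasDerivAt_const y₀ x₀).prodMk (hasDerivAt_id y₀))).unique h₂
  filter_upwards [hG.hasFDerivAt.isLittleO.def hε] with p hp
  have hlin : fderiv ℝ G (x₀, y₀) (p - (x₀, y₀)) = g₁ * (p.1 - x₀) + g₂ * (p.2 - y₀) := by
    have hsplit : p - (x₀, y₀) =
        (p.1 - x₀) • ((1, 0) : ℝ × ℝ) + (p.2 - y₀) • ((0, 1) : ℝ × ℝ) := by
      ext <;> simp
    rw [hsplit, map_add, map_smul, map_smul, e₁, e₂, smul_eq_mul, smul_eq_mul]
    ring
  rw [hlin, Real.norm_eq_abs] at hp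
  refine hp.trans (mul_le_mul_of_nonneg_left ?_ hε.le)
  simp only [Prod.norm_def, Prod.fst_sub, Prod.snd_sub, Real.norm_eq_abs]
  exact max_le (le_add_of_nonneg_right (abs_nonneg _)) (le_add_of_nonneg_left (abs_nonneg _))

theorem differentiableAt_qfun {η ρ0 Veff L B Kd s : ℝ} (hB : 0 < B) (hKd : 0 < Kd)
    (hρ0 : 0 < ρ0) (hs : s < L) : DifferentiableAt ℝ (qfun η ρ0 Veff L B Kd) s := by
  have hne : B * ρ0 + Kd * (L - s) ≠ 0 := by
    have : 0 < L - s := sub_pos.2 hs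
    positivity
  unfold qfun
  fun_prop (disch := assumption)

/-- The screw speed imposed by the pressure feedback, as a function of the pressure
coefficient `q`. -/
theorem eq_div_of_pressure_feedback {N Ne k1 q qe : ℝ} (hNe : Ne ≠ 0) (hden : 1 - k1 * qe ≠ 0)
    (h : N = Ne + k1 * (N * q - Ne * qe)) : N = Ne * (1 - k1 * qe) / (1 - k1 * q) := by
  have hmul : N * (1 - k1 * q) = Ne * (1 - k1 * qe) := by linear_combination h
  exact eq_div_of_mul_eq (right_ne_zero_of_mul (hmul ▸ mul_ne_zero hNe hden)) hmul

theorem hasDerivAt_feedback_speed {q : ℝ → ℝ} {q' x Ne k1 : ℝ} (hq : HasDerivAt q q' x)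
    (hden : 1 - k1 * q x ≠ 0) :
    HasDerivAt (fun s => Ne * (1 - k1 * q x) / (1 - k1 * q s))
      (k1 * (Ne * q') / (1 - k1 * q x)) x := by
  refine ((hasDerivAt_const x (Ne * (1 - k1 * q x))).fun_div ((hq.const_mul k1).const_sub 1)
    hden).congr_deriv ?_
  field_simp
  ring

/-- Linearization of the inlet filling ratio under the pressure feedback. -/
theorem hasDerivAt_feedback_inlet {q n : ℝ → ℝ} {q' x Ne k1 k2 r c : ℝ}
    (hq : HasDerivAt q q' x) (hn : HasDerivAt n (k1 * (Ne * q') / (1 - k1 * q x)) x)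
    (hnx : n x = Ne) (hNe : Ne ≠ 0) (hr : r ≠ 0) (hden : 1 - k1 * q x ≠ 0) :
    HasDerivAt (fun s => (r * Ne * c + k2 * (n s * q s - Ne * q x)) / (r * n s))
      (Ne * q' * (k2 - c * r * k1) / (r * Ne * (1 - k1 * q x))) x := by
  refine (((((hn.fun_mul hq).sub_const _).const_mul k2).const_add (r * Ne * c)).fun_div
    (hn.const_mul r) (by rw [hnx]; positivity)).congr_deriv ?_
  rw [hnx]
  field_simp
  ring

/-- Lemma 1 of the paper: under the stabilizability conditions on the gains,
there are positive constants `A1, γ1, β0, β1, δ1, δ` such that along every classical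
solution of the closed-loop extrusion model, at each time `t ≥ 0` where the solution is
`δ`-close to the equilibrium, the Lyapunov candidate
`V(t) = (l(t) − le)² + A1·∫₀¹ e^{−γ1 x}(f(t,x) − fpe)² dx` is differentiable with
`V'(t) ≤ −β0·(l(t) − le)² − β1·∫₀¹ e^{−γ1 x}(f(t,x) − fpe)² dx − δ1·(f(t,1) − fpe)²`. -/
theorem lyapunov_V0V1_decay
    (L B Kd ζ η ρ0 Seff Veff : ℝ)
    (hL : 0 < L) (hB : 0 < B) (hKd : 0 < Kd) (hζ : 0 < ζ) (hη : 0 < η)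
    (hρ0 : 0 < ρ0) (hSeff : 0 < Seff) (hVeff : 0 < Veff)
    (le fpe Ne : ℝ)
    (hle : le ∈ Set.Ioo 0 L) (hfpe : fpe ∈ Set.Ioo (0:ℝ) 1) (hNe : 0 < Ne)
    (heq : (Kd / η) * Ne * qfun η ρ0 Veff L B Kd le = ρ0 * Veff * Ne * fpe)
    (a1 a2 a3 b1 b2 : ℝ)
    (ha1 : a1 = deriv (fun s => Ffun η ρ0 Veff Seff L B Kd s Ne fpe) le)
    (ha2 : a2 = deriv (fun s => Ffun η ρ0 Veff Seff L B Kd le s fpe) Ne)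
    (ha3 : a3 = deriv (fun s => Ffun η ρ0 Veff Seff L B Kd le Ne s) fpe)
    (hb1 : b1 = Ne * deriv (qfun η ρ0 Veff L B Kd) le)
    (hb2 : b2 = qfun η ρ0 Veff L B Kd le)
    (k1 k2 : ℝ)
    (hden : 1 - k1 * b2 ≠ 0)
    (hθ0 : a1 + k1 * a2 * b1 / (1 - k1 * b2) < 0)
    (hgain : |a3 * b1 * (k2 - fpe * ρ0 * Veff * k1) / (ρ0 * Veff * Ne * (1 - k1 * b2))| <
        |a1 + k1 * a2 * b1 / (1 - k1 * b2)|) :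
    ∃ A1 > (0:ℝ), ∃ γ1 > (0:ℝ), ∃ β0 > (0:ℝ), ∃ β1 > (0:ℝ), ∃ δ1 > (0:ℝ), ∃ δ > (0:ℝ),
      ∀ (l : ℝ → ℝ) (f : ℝ → ℝ → ℝ) (N Fi ΔP : ℝ → ℝ),
        -- regularity: l and f are C¹
        ContDiff ℝ 1 l →
        ContDiff ℝ 1 (Function.uncurry f) →
        -- state constraints
        (∀ t, 0 ≤ t → l t ∈ Set.Ioo 0 L) →
        (∀ t, 0 ≤ t → ∀ x ∈ Set.Icc (0:ℝ) 1, f t x < 1) →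
        -- die pressure difference and feedback controls
        (∀ t, 0 ≤ t → ΔP t = N t * qfun η ρ0 Veff L B Kd (l t)) →
        (∀ t, 0 ≤ t → N t = Ne + k1 * (ΔP t - Ne * qfun η ρ0 Veff L B Kd le)) →
        (∀ t, 0 ≤ t → 0 < N t) →
        (∀ t, 0 ≤ t →
          Fi t = ρ0 * Veff * Ne * fpe + k2 * (ΔP t - Ne * qfun η ρ0 Veff L B Kd le)) →
        -- interface dynamics
        (∀ t, 0 ≤ t → HasDerivAt l
          (((Kd / η) * ΔP t - ρ0 * Veff * N t * f t 1) / (ρ0 * Seff * (1 - f t 1))) t) →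
        -- transport equation with normalized speed α(t,x) = (ζ·N(t) − x·l'(t))/l(t)
        (∀ t, 0 ≤ t → ∀ x ∈ Set.Icc (0:ℝ) 1,
          deriv (fun s => f s x) t
            + ((ζ * N t - x * deriv l t) / l t) * deriv (f t) x = 0) →
        -- boundary condition
        (∀ t, 0 ≤ t → f t 0 = Fi t / (ρ0 * Veff * N t)) →
        ∀ t, 0 ≤ t →
          |l t - le| + |N t - Ne| + |f t 1 - fpe| ≤ δ →
          ∃ v : ℝ,
            HasDerivAt (fun s => (l s - le) ^ 2
              + A1 * ∫ x in (0:ℝ)..1, Real.exp (-γ1 * x) * (f s x - fpe) ^ 2) v t ∧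
            v ≤ -β0 * (l t - le) ^ 2
              - β1 * (∫ x in (0:ℝ)..1, Real.exp (-γ1 * x) * (f t x - fpe) ^ 2)
              - δ1 * (f t 1 - fpe) ^ 2 := by
  obtain ⟨hle0, hleL⟩ := hle
  obtain ⟨hfpe0, hfpe1⟩ := hfpe
  set q := qfun η ρ0 Veff L B Kd with hqdef
  have hqd : HasDerivAt q (deriv q le) le :=
    (differentiableAt_qfun hB hKd hρ0 hleL).hasDerivAt
  have hequil : Kd / η * q le = ρ0 * Veff * fpe := by
    apply mul_right_cancel₀ hNe.ne'
    linear_combination heq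
  have hfne : 1 - fpe ≠ 0 := by linarith
  have hden' : ρ0 * Seff * (1 - fpe) ≠ 0 := by positivity
  have ha2z : a2 = 0 := by
    have h : (fun s => Ffun η ρ0 Veff Seff L B Kd le s fpe) = fun _ => 0 := by
      funext s
      simp only [Ffun, ← hqdef]
      rw [div_eq_zero_iff]
      left
      linear_combination s * hequil
    rw [ha2, h, deriv_const]
  have ha1e : a1 = Kd / η * Ne * deriv q le / (ρ0 * Seff * (1 - fpe)) := by
    rw [ha1]
    exact (((hqd.const_mul (Kd / η * Ne)).sub_const _).div_const _).deriv
  have hF3 : HasDerivAt (fun s => Ffun η ρ0 Veff Seff L B Kd le Ne s) a3 fpe := by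
    rw [ha3]
    refine DifferentiableAt.hasDerivAt ?_
    simp only [Ffun]
    fun_prop (disch := assumption)
  subst hb2
  set n : ℝ → ℝ := fun s => Ne * (1 - k1 * q le) / (1 - k1 * q s) with hn
  have hnle : n le = Ne := mul_div_cancel_right₀ _ hden
  have hnd : HasDerivAt n (k1 * b1 / (1 - k1 * q le)) le := by
    rw [hb1]
    exact hasDerivAt_feedback_speed hqd hden
  set θ := a1 + k1 * a2 * b1 / (1 - k1 * q le) with hθ
  set θ1 := b1 * (k2 - fpe * (ρ0 * Veff) * k1) / (ρ0 * Veff * Ne * (1 - k1 * q le)) with hθ1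
  set G : ℝ × ℝ → ℝ := fun p =>
    (Kd / η * (n p.1 * q p.1) - ρ0 * Veff * n p.1 * p.2) / (ρ0 * Seff * (1 - p.2)) with hG
  set I : ℝ → ℝ := fun s =>
    (ρ0 * Veff * Ne * fpe + k2 * (n s * q s - Ne * q le)) / (ρ0 * Veff * n s) with hI
  have hG0 : G (le, fpe) = 0 := by
    simp only [hG, hnle]
    rw [div_eq_zero_iff]
    left
    linear_combination Ne * hequil
  have hI0 : I le = fpe := by
    simp only [hI, hnle]
    field_simp
    ring
  have hGd : DifferentiableAt ℝ G (le, fpe) := by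
    have h1 : DifferentiableAt ℝ (fun p : ℝ × ℝ => n p.1) (le, fpe) :=
      DifferentiableAt.comp (g := n) (le, fpe) hnd.differentiableAt differentiableAt_fst
    have h2 : DifferentiableAt ℝ (fun p : ℝ × ℝ => q p.1) (le, fpe) :=
      DifferentiableAt.comp (g := q) (le, fpe) hqd.differentiableAt differentiableAt_fst
    have h3 : DifferentiableAt ℝ (fun p : ℝ × ℝ => ρ0 * Seff * (1 - p.2)) (le, fpe) := by
      fun_prop
    simp only [hG, div_eq_mul_inv _ (ρ0 * Seff * _)]
    exact (((h1.fun_mul h2).const_mul (Kd / η)).fun_sub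
      ((h1.const_mul (ρ0 * Veff)).fun_mul differentiableAt_snd)).fun_mul (h3.fun_inv hden')
  have hG1 : HasDerivAt (fun s => G (s, fpe)) θ le := by
    refine ((((hnd.fun_mul hqd).const_mul (Kd / η)).fun_sub
      ((hnd.const_mul (ρ0 * Veff)).mul_const fpe)).div_const
        (ρ0 * Seff * (1 - fpe))).congr_deriv ?_
    rw [hθ, ha2z, ha1e, hnle, mul_zero, zero_mul, zero_div, add_zero]
    congr 1
    linear_combination (k1 * b1 / (1 - k1 * q le)) * hequil
  have hG2 : HasDerivAt (fun s => G (le, s)) a3 fpe := by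
    convert hF3 using 2 with s
    simp only [hG, Ffun, hnle, ← hqdef]
    ring
  have hId : HasDerivAt I θ1 le := by
    rw [hθ1, hb1]
    exact hasDerivAt_feedback_inlet hqd (hb1 ▸ hnd) hnle hNe.ne' (by positivity) hden
  have hgain' : |a3 * θ1| < |θ| := by
    rw [hθ1, ← mul_div_assoc, ← mul_assoc, ← mul_assoc fpe]
    exact hgain
  obtain ⟨A, hA, γ, hγ, c, hc, hquad⟩ := exists_weight_quadratic_form_neg hθ0 hgain'
  set α0 := ζ * Ne / le with hα0
  have hα0pos : 0 < α0 := by positivity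
  obtain ⟨ε, hε, hpert⟩ := exists_perturbation_margin hA hα0pos hγ hc hquad
  set μ := min (ε / 2) (γ * α0 / (2 * (2 * γ + 1))) with hμ
  have hμpos : 0 < μ := by positivity
  have hμε : μ ≤ ε / 2 := min_le_left _ _
  have hμγ : (2 * γ + 1) * μ ≤ γ * α0 / 2 := by
    have h : μ ≤ γ * α0 / (2 * (2 * γ + 1)) := min_le_right _ _
    rw [le_div_iff₀ (by positivity)] at h
    linarith
  have hfst : Filter.Tendsto (Prod.fst : ℝ × ℝ → ℝ) (nhds (le, fpe)) (nhds le) :=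
    continuous_fst.tendsto _
  have evG := eventually_abs_sub_partial_le hGd hG1 hG2 hε
  have evI : ∀ᶠ p : ℝ × ℝ in nhds (le, fpe),
      |I p.1 - fpe - θ1 * (p.1 - le)| ≤ ε * |p.1 - le| := by
    filter_upwards [hfst.eventually (hId.hasFDerivAt.isLittleO.def hε)] with p hp
    simpa [hI0, mul_comm] using hp
  have evα : ∀ᶠ p : ℝ × ℝ in nhds (le, fpe), |ζ * n p.1 / p.1 - α0| ≤ μ := by
    have hcont : ContinuousAt (fun s => ζ * n s / s) le :=
      (hnd.continuousAt.const_mul ζ).div continuousAt_id hle0.ne'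
    have htend : Filter.Tendsto (fun s => ζ * n s / s) (nhds le) (nhds α0) := by
      simpa only [ContinuousAt, hnle] using hcont
    filter_upwards [(htend.comp hfst).eventually (Metric.closedBall_mem_nhds α0 hμpos)] with p hp
    exact hp
  have evb : ∀ᶠ p : ℝ × ℝ in nhds (le, fpe), |G p / p.1| ≤ μ := by
    have hcont : ContinuousAt (fun p : ℝ × ℝ => G p / p.1) (le, fpe) :=
      hGd.continuousAt.div continuousAt_fst hle0.ne'
    have htend : Filter.Tendsto (fun p : ℝ × ℝ => G p / p.1) (nhds (le, fpe)) (nhds 0) := by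
      simpa only [ContinuousAt, hG0, zero_div] using hcont
    filter_upwards [htend.eventually (Metric.closedBall_mem_nhds 0 hμpos)] with p hp
    simpa [abs_div] using hp
  obtain ⟨δ, hδ, hball⟩ := Metric.eventually_nhds_iff.1 (evG.and (evI.and (evα.and evb)))
  refine ⟨A / α0, by positivity, γ, hγ, c / 2, by positivity, A / α0 * (γ * α0 / 2),
    by positivity, c / 2, by positivity, δ / 2, by positivity, ?_⟩
  intro l f N Fi ΔP _ hf _ _ hΔP hN _ hFi hl hpde hbc t ht hclose
  have hNt : N t = n (l t) :=
    eq_div_of_pressure_feedback hNe.ne' hden (by rw [← hΔP t ht]; exact hN t ht)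
  have hlt : HasDerivAt l (G (l t, f t 1)) t := by
    simpa only [hG, hΔP t ht, hNt] using hl t ht
  have hf0 : f t 0 = I (l t) := by
    rw [hbc t ht, hFi t ht, hΔP t ht, hNt]
  have hdist : dist (l t, f t 1) (le, fpe) < δ := by
    rw [Prod.dist_eq, Real.dist_eq, Real.dist_eq, max_lt_iff]
    constructor <;>
      linarith [abs_nonneg (l t - le), abs_nonneg (N t - Ne), abs_nonneg (f t 1 - fpe)]
  obtain ⟨eG, eI, eα, eb⟩ := hball hdist
  simp only [hG0, sub_zero] at eG eI eα eb
  set a := ζ * n (l t) / l t with ha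
  set b := G (l t, f t 1) / l t with hb
  obtain ⟨hα1, hα2⟩ := abs_le.1 eα
  obtain ⟨hb1', hb2'⟩ := abs_le.1 eb
  obtain ⟨D, hD, hDle⟩ := weighted_energy_decay_of_transport (γ := γ) (c := fpe)
    (κ := γ * α0 / 2) hf (t := t) (a := a) (b := b)
    (fun x hx => by
      have h := hpde t ht x hx
      rwa [hlt.deriv, hNt, sub_div, mul_div_assoc x] at h)
    (fun x hx => by
      have h1 : x * b ≤ μ := (le_abs_self _).trans <| by
        rw [abs_mul, abs_of_nonneg hx.1]
        exact (mul_le_of_le_one_left (abs_nonneg b) hx.2).trans eb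
      have h2 := mul_le_mul_of_nonneg_left
        (show α0 - 2 * μ ≤ a - x * b by linarith) hγ.le
      linarith)
  have hsq := ((hlt.sub_const le).fun_pow 2).fun_add (hD.const_mul (A / α0))
  refine ⟨_, hsq, ?_⟩
  have hmain := hpert (l t - le) (f t 1 - fpe) (G (l t, f t 1)) (f t 0 - fpe) a (a - b)
    eG (by rw [hf0]; exact eI) (eα.trans (by linarith))
    (abs_le.2 ⟨by linarith, by linarith⟩)
  have hDle' := mul_le_mul_of_nonneg_left hDle (by positivity : 0 ≤ A / α0)
  simp only [Nat.cast_ofNat, Nat.add_one_sub_one, pow_one]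
  linarith
end
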